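/- Let Q satisfy Assumption (A), set Ω = {(x,v) ∈ ℝ⁶ : Q(x,v) > 0}, and for (x,v) ∈ Ω set F'_e(x,v) = ∂F/∂e(|v|²/2 + φ_Q(x), |x×v|²), which is negative on Ω. Then for every spherically symmetric ξ ∈ C^∞_c(Ω) which is odd in v (i.e. ξ(x,−v) = −ξ(x,v)), the function g = Tξ := v·∇_x ξ − ∇φ_Q·∇_v ξ (extended by 0 outside Ω) satisfies the Antonov coercivity inequality ∫_Ω (Tξ)²/|F'_e| dx dv − ∫_{ℝ³} |∇φ_g|² dx ≥ ∫_Ω (ξ²/|F'_e|) · (φ_Q'(|x|)/|x|) dx dv, where φ_Q'(r) denotes the radial derivative of φ_Q. -/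

import Mathlib

noncomputable section

open MeasureTheory Real Filter Set Topology
open scoped ENNReal NNReal

abbrev E3 : Type := EuclideanSpace ℝ (Fin 3)
abbrev Phase : Type := E3 × E3

/-- Spherical symmetry: invariance under all rotations of `ℝ³` acting jointly on `x` and `v`. -/
def SphSym (f : Phase → ℝ) : Prop :=
  ∀ R : E3 ≃ₗᵢ[ℝ] E3, LinearMap.det (R.toLinearEquiv : E3 →ₗ[ℝ] E3) = 1 →
    ∀ z : Phase, f (R z.1, R z.2) = f z

/-- `|x × v|²`, via the Lagrange identity. -/
def ellOf (z : Phase) : ℝ := ‖z.1‖ ^ 2 * ‖z.2‖ ^ 2 - (inner ℝ z.1 z.2 : ℝ) ^ 2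

/-- Spatial density. -/
def rhoF (f : Phase → ℝ) (x : E3) : ℝ := ∫ v : E3, f (x, v)

/-- Poisson field. -/
def phiF (f : Phase → ℝ) (x : E3) : ℝ := - ∫ y : E3, rhoF f y / (4 * π * ‖x - y‖)

/-- Radial representation of the Poisson field. -/
def phiRad (f : Phase → ℝ) (r : ℝ) : ℝ :=
  phiF f (r • (EuclideanSpace.single (0 : Fin 3) (1:ℝ)))

def mass (f : Phase → ℝ) : ℝ := ∫ z : Phase, f z

def kineticE (f : Phase → ℝ) : ℝ := ∫ z : Phase, ‖z.2‖ ^ 2 * f z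

def gradPhi (f : Phase → ℝ) (x : E3) : E3 := gradient (phiF f) x

def fieldSq (f : Phase → ℝ) : ℝ := ∫ x : E3, ‖gradPhi f x‖ ^ 2

/-- `L²` distance between the force fields of `f` and `g`. -/
def fieldDist (f g : Phase → ℝ) : ℝ :=
  Real.sqrt (∫ x : E3, ‖gradPhi f x - gradPhi g x‖ ^ 2)

/-- The Hamiltonian. -/
def Ham (f : Phase → ℝ) : ℝ := kineticE f / 2 - fieldSq f / 2

/-- The norm of the energy space. -/
def eNormE (f : Phase → ℝ) : ℝ≥0∞ :=
  eLpNorm f 1 volume + eLpNorm f ⊤ volume +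
    ∫⁻ z : Phase, (‖z.2‖₊ : ℝ≥0∞) ^ 2 * (‖f z‖₊ : ℝ≥0∞)

def memE (f : Phase → ℝ) : Prop := Measurable f ∧ (∀ z, 0 ≤ f z) ∧ eNormE f < ⊤

def memErad (f : Phase → ℝ) : Prop := memE f ∧ SphSym f

/-- Density of the measure `ν_ℓ`. -/
def nuDens (ℓ : ℝ) (p : ℝ × ℝ) : ℝ≥0∞ :=
  if 0 < p.1 ∧ ℓ < p.1 ^ 2 * p.2 ^ 2 then
    ENNReal.ofReal (4 * π ^ 2 * p.1 * |p.2| / Real.sqrt (p.1 ^ 2 * p.2 ^ 2 - ℓ))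
  else 0

def nuMeas (ℓ : ℝ) : Measure (ℝ × ℝ) := volume.withDensity (nuDens ℓ)

/-- Representative phase point with `|x| = r`, `|v| = |u|`, `|x×v|² = ℓ` and
`x·v = sign u · √(r²u²-ℓ)`. -/
def radPoint (r u ℓ : ℝ) : Phase :=
  (r • (EuclideanSpace.single (0 : Fin 3) (1:ℝ)),
   (Real.sign u * Real.sqrt (r ^ 2 * u ^ 2 - ℓ) / r) • (EuclideanSpace.single (0 : Fin 3) (1:ℝ))
     + (Real.sqrt ℓ / r) • (EuclideanSpace.single (1 : Fin 3) (1:ℝ)))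

/-- Distribution function of `f` at kinetic momentum `ℓ`. -/
def muDist (f : Phase → ℝ) (s ℓ : ℝ) : ℝ≥0∞ :=
  nuMeas ℓ {p : ℝ × ℝ | s < f (radPoint p.1 p.2 ℓ)}

/-- `g ∈ Eq(f)` : `g` is nonnegative, spherically symmetric and equimeasurable to `f`
at (almost) every kinetic momentum `ℓ`. -/
def EqMeas (f g : Phase → ℝ) : Prop :=
  (∀ z, 0 ≤ g z) ∧ SphSym g ∧
    ∀ s : ℝ, 0 < s →
      ∀ᵐ ℓ ∂(volume.restrict (Ioi (0:ℝ))), muDist g s ℓ = muDist f s ℓ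

/-- Schwarz symmetrization of `f` at fixed `ℓ`. -/
def schwarz (f : Phase → ℝ) (t ℓ : ℝ) : ℝ :=
  if ENNReal.ofReal t < muDist f 0 ℓ then
    sSup {s : ℝ | 0 ≤ s ∧ ENNReal.ofReal t < muDist f s ℓ}
  else 0

/-- Effective potential. -/
def psiPot (φ : ℝ → ℝ) (ℓ r : ℝ) : ℝ := φ r + ℓ / (2 * r ^ 2)

def eMinPot (φ : ℝ → ℝ) (ℓ : ℝ) : ℝ := sInf (psiPot φ ℓ '' Ioi 0)

def r1Pot (φ : ℝ → ℝ) (e ℓ : ℝ) : ℝ := sInf {r : ℝ | 0 < r ∧ psiPot φ ℓ r < e}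

def r2Pot (φ : ℝ → ℝ) (e ℓ : ℝ) : ℝ := sSup {r : ℝ | 0 < r ∧ psiPot φ ℓ r < e}

/-- The Jacobian `a_φ(e, ℓ)` (meaningful for `e < 0`). -/
def aPot (φ : ℝ → ℝ) (e ℓ : ℝ) : ℝ :=
  8 * π ^ 2 * Real.sqrt 2 * ∫ r in Ioi (0:ℝ), Real.sqrt (max (e - psiPot φ ℓ r) 0)

/-- Inverse of the bijection `e ↦ a_φ(e,ℓ)` from `(e_{φ,ℓ},0)` onto `(0,∞)`. -/
def aPotInv (φ : ℝ → ℝ) (s ℓ : ℝ) : ℝ :=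
  sSup {e : ℝ | eMinPot φ ℓ < e ∧ e < 0 ∧ aPot φ e ℓ < s}

/-- Microscopic energy w.r.t. the Poisson field of `g`. -/
def microE (g : Phase → ℝ) (z : Phase) : ℝ := ‖z.2‖ ^ 2 / 2 + phiF g z.1

/-- Rearrangement of `f` with respect to the microscopic energy of the field of `g`. -/
def rearr (f g : Phase → ℝ) (z : Phase) : ℝ :=
  if microE g z < 0 then
    schwarz f (aPot (phiRad g) (microE g z) (ellOf z)) (ellOf z)
  else 0

/-- Assumption (A). -/
structure AssumptionA (Q : Phase → ℝ) (F : ℝ → ℝ → ℝ) (e₀ : ℝ) : Prop where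
  contQ : Continuous Q
  nonneg : ∀ z, 0 ≤ Q z
  nonzero : Q ≠ 0
  cpt : HasCompactSupport Q
  sph : SphSym Q
  eqF : ∀ z : Phase, Q z = F (microE Q z) (ellOf z)
  Fnonneg : ∀ e ℓ, 0 ≤ ℓ → 0 ≤ F e ℓ
  Fcont : ContinuousOn (fun p : ℝ × ℝ => F p.1 p.2) {p : ℝ × ℝ | 0 ≤ p.2}
  e₀neg : e₀ < 0
  Fsupp : ∀ e ℓ, 0 ≤ ℓ → 0 < F e ℓ → e < e₀
  FC1 : ContDiffOn ℝ 1 (fun p : ℝ × ℝ => F p.1 p.2) {p : ℝ × ℝ | 0 ≤ p.2 ∧ 0 < F p.1 p.2}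
  FeNeg : ∀ e ℓ, 0 ≤ ℓ → 0 < F e ℓ → deriv (fun e' => F e' ℓ) e < 0

/-- The reduced functional `J_{f^*}(φ_g) = H(f^{*φ_g}) + ½|∇φ_g − ∇φ_{f^{*φ_g}}|²`. -/
def Jred (f g : Phase → ℝ) : ℝ :=
  Ham (rearr f g) + (∫ x : E3, ‖gradPhi g x - gradPhi (rearr f g) x‖ ^ 2) / 2

def distL1 (f g : Phase → ℝ) : ℝ := ∫ z : Phase, |f z - g z|

def distL1v (f g : Phase → ℝ) : ℝ := ∫ z : Phase, ‖z.2‖ ^ 2 * |f z - g z|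


/-- The linearized transport operator `T ξ = v·∇_x ξ − ∇φ_Q·∇_v ξ`. -/
def transportT (Q ξ : Phase → ℝ) (z : Phase) : ℝ :=
  fderiv ℝ ξ z (z.2, -(gradPhi Q z.1))



abbrev e0v : E3 := EuclideanSpace.single (0 : Fin 3) (1:ℝ)

lemma halfTurn (u : E3) (hu : u ≠ 0) : ∃ R : E3 ≃ₗᵢ[ℝ] E3,
    LinearMap.det (R.toLinearEquiv : E3 →ₗ[ℝ] E3) = 1 ∧ R u = u ∧
      ∀ v, inner ℝ u v = 0 → R v = -v := by
  refine ⟨(ℝ ∙ u).reflection, ?_, ?_, ?_⟩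
  · have h := Submodule.det_reflection (𝕜 := ℝ) (ℝ ∙ u)
    have h2 : Module.finrank ℝ (ℝ ∙ u)ᗮ = 2 := by
      have := (ℝ ∙ u).finrank_add_finrank_orthogonal
      rw [finrank_span_singleton hu] at this
      simp at this
      omega
    rw [h2] at h
    simpa using h
  · exact Submodule.reflection_mem_subspace_eq_self (Submodule.mem_span_singleton_self u)
  · intro v hv
    apply Submodule.reflection_mem_subspace_orthogonalComplement_eq_neg
    rwa [Submodule.mem_orthogonal_singleton_iff_inner_right]

lemma exists_perp (v : E3) : ∃ u : E3, u ≠ 0 ∧ inner ℝ u v = 0 := by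
  by_cases h : v 0 = 0 ∧ v 1 = 0
  · refine ⟨e0v, ?_, ?_⟩
    · intro h; have := congrArg (fun w : E3 => w 0) h; simp [e0v] at this
    · simp [e0v, EuclideanSpace.inner_single_left, h.1]
  · refine ⟨!₂[-v 1, v 0, 0], ?_, ?_⟩
    · intro h'
      apply h
      have h0 := congrArg (fun w : E3 => w 0) h'
      have h1 := congrArg (fun w : E3 => w 1) h'
      simp at h0 h1
      exact ⟨h1, h0⟩
    · simp [PiLp.inner_apply, Fin.sum_univ_three]; ring

lemma exists_rot (x y : E3) (h : ‖x‖ = ‖y‖) : ∃ R : E3 ≃ₗᵢ[ℝ] E3,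
    LinearMap.det (R.toLinearEquiv : E3 →ₗ[ℝ] E3) = 1 ∧ R x = y := by
  by_cases hxy : x + y = 0
  · obtain ⟨u, hu, hux⟩ := exists_perp x
    obtain ⟨R, h1, h2, h3⟩ := halfTurn u hu
    refine ⟨R, h1, ?_⟩
    rw [h3 x hux]
    exact (eq_neg_of_add_eq_zero_right hxy).symm
  · obtain ⟨R, h1, h2, h3⟩ := halfTurn (x + y) hxy
    refine ⟨R, h1, ?_⟩
    have h4 : inner ℝ (x + y) (x - y) = 0 := by
      simp only [inner_add_left, inner_sub_right, real_inner_self_eq_norm_sq, h,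
        real_inner_comm x y]
      ring
    have h5 := h3 _ h4
    rw [map_add] at h2
    rw [map_sub] at h5
    have : (2:ℝ) • R x = (2:ℝ) • y := by
      calc (2:ℝ) • R x = (R x + R y) + (R x - R y) := by module
        _ = (x + y) + -(x - y) := by rw [h2, h5]
        _ = (2:ℝ) • y := by module
    exact smul_right_injective _ two_ne_zero this

lemma norm_e0v : ‖e0v‖ = 1 := by simp [e0v]

lemma odd_zero {ξ : Phase → ℝ} (hs : SphSym ξ) (ho : ∀ z : Phase, ξ (z.1, -z.2) = - ξ z)
    (x v : E3) (h : inner ℝ x v = 0) : ξ (x, v) = 0 := by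
  have key : ξ (x, -v) = ξ (x, v) := by
    by_cases hx : x = 0
    · subst hx
      obtain ⟨u, hu, huv⟩ := exists_perp v
      obtain ⟨R, h1, h2, h3⟩ := halfTurn u hu
      have := hs R h1 (0, v)
      simpa [h3 v huv] using this
    · obtain ⟨R, h1, h2, h3⟩ := halfTurn x hx
      have := hs R h1 (x, v)
      simpa [h3 v h, h2] using this
  have := ho (x, v)
  simp only at this
  linarith

lemma rhoF_rot {f : Phase → ℝ} (hs : SphSym f) (R : E3 ≃ₗᵢ[ℝ] E3)
    (hR : LinearMap.det (R.toLinearEquiv : E3 →ₗ[ℝ] E3) = 1) (x : E3) :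
    rhoF f (R x) = rhoF f x := by
  unfold rhoF
  rw [← R.measurePreserving.integral_comp R.toHomeomorph.measurableEmbedding]
  exact integral_congr_ae (Eventually.of_forall fun v => hs R hR (x, v))

lemma rhoF_radial {f : Phase → ℝ} (hs : SphSym f) (x : E3) :
    rhoF f x = rhoF f (‖x‖ • e0v) := by
  obtain ⟨R, h1, h2⟩ := exists_rot x (‖x‖ • e0v) (by simp [norm_smul])
  rw [← h2, rhoF_rot hs R h1]

lemma rhoF_cont {f : Phase → ℝ} (hc : Continuous f) (hs : HasCompactSupport f) :
    Continuous (rhoF f) := by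
  unfold rhoF
  have hK : IsCompact (Prod.snd '' tsupport f) := hs.image continuous_snd
  have : (fun x : E3 => ∫ v, f (x, v)) = fun x => ∫ v in Prod.snd '' tsupport f, f (x, v) := by
    ext x
    symm
    apply setIntegral_eq_integral_of_forall_compl_eq_zero
    intro v hv
    by_contra h
    exact hv ⟨(x, v), subset_tsupport _ h, rfl⟩
  rw [this]
  exact continuous_parametric_integral_of_continuous (by exact hc) hK

lemma rhoF_supp {f : Phase → ℝ} (hs : HasCompactSupport f) :
    HasCompactSupport (rhoF f) := by
  apply HasCompactSupport.intro (hs.image continuous_fst)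
  intro x hx
  have : ∀ v, f (x, v) = 0 := by
    intro v
    by_contra h
    exact hx ⟨(x, v), subset_tsupport _ h, rfl⟩
  simp [rhoF, this]



lemma mp_E3 : MeasurePreserving (fun y : E3 => ((y 0, (y 1, y 2)) : ℝ × (ℝ × ℝ))) := by
  have h1 : MeasurePreserving (fun y : E3 => (WithLp.ofLp y : Fin 3 → ℝ)) :=
    PiLp.volume_preserving_ofLp (Fin 3)
  have h2 := volume_preserving_piFinSuccAbove (fun _ : Fin 3 => ℝ) 0
  have h3 : MeasurePreserving (MeasurableEquiv.finTwoArrow (α := ℝ)) := volume_preserving_finTwoArrow ℝ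
  have h4 := (MeasurePreserving.id (volume : Measure ℝ)).prod h3
  have h5 := (h4.comp h2).comp h1
  exact h5

lemma arch1 (f : ℝ × ℝ → ℝ≥0∞) (hf : Measurable f) :
    ∫⁻ y : E3, f (‖y‖, y 0) = ∫⁻ z : ℝ, ∫⁻ p : ℝ × ℝ, f (√(z ^ 2 + (p.1 ^ 2 + p.2 ^ 2)), z) := by
  have hg : Measurable (fun q : ℝ × (ℝ × ℝ) => f (√(q.1 ^ 2 + (q.2.1 ^ 2 + q.2.2 ^ 2)), q.1)) := by
    fun_prop
  have := mp_E3.lintegral_comp hg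
  rw [Measure.volume_eq_prod, lintegral_prod _ hg.aemeasurable] at this
  rw [← this]
  apply lintegral_congr
  intro y
  simp only
  rw [EuclideanSpace.norm_eq, Fin.sum_univ_three]
  simp [add_assoc]

lemma arch2 (h : ℝ → ℝ≥0∞) (hh : Measurable h) :
    ∫⁻ p : ℝ × ℝ, h (p.1 ^ 2 + p.2 ^ 2) =
      ∫⁻ s in Ioi (0:ℝ), ENNReal.ofReal (2 * π * s) * h (s ^ 2) := by
  rw [← lintegral_comp_polarCoord_symm]
  have : ∀ p : ℝ × ℝ, ENNReal.ofReal p.1 • h ((polarCoord.symm p).1 ^ 2 + (polarCoord.symm p).2 ^ 2)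
      = ENNReal.ofReal p.1 * h (p.1 ^ 2) := by
    intro p
    simp only [polarCoord_symm_apply, smul_eq_mul]
    congr 2
    have := sin_sq_add_cos_sq p.2
    linear_combination p.1 ^ 2 * this
  simp_rw [this, polarCoord_target]
  rw [Measure.volume_eq_prod, setLIntegral_prod _ (by fun_prop)]
  apply setLIntegral_congr_fun measurableSet_Ioi
  intro s hs
  simp only [lintegral_const, Measure.restrict_apply MeasurableSet.univ, univ_inter, Real.volume_Ioo]
  rw [mul_right_comm, ← ENNReal.ofReal_mul (le_of_lt hs)]
  congr 2
  ring

lemma arch3 (z : ℝ) (f : ℝ → ℝ≥0∞) :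
    ∫⁻ s in Ioi (0:ℝ), ENNReal.ofReal (2 * π * s) * f (√(z ^ 2 + s ^ 2)) =
      ∫⁻ t in Ioi |z|, ENNReal.ofReal (2 * π * t) * f t := by
  have himg : (fun s : ℝ => √(z ^ 2 + s ^ 2)) '' Ioi 0 = Ioi |z| := by
    ext t
    constructor
    · rintro ⟨s, hs, rfl⟩
      have hs : 0 < s := hs
      simp only [mem_Ioi]
      apply Real.lt_sqrt_of_sq_lt
      rw [sq_abs]; nlinarith
    · intro ht
      have ht : |z| < t := ht
      have ht0 : 0 < t := (abs_nonneg z).trans_lt ht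
      have hz : z ^ 2 < t ^ 2 := by rw [← sq_abs z]; exact pow_lt_pow_left₀ ht (abs_nonneg _) two_ne_zero
      refine ⟨√(t ^ 2 - z ^ 2), Real.sqrt_pos.2 (by linarith), ?_⟩
      simp only
      rw [Real.sq_sqrt (by linarith)]
      rw [add_sub_cancel, Real.sqrt_sq ht0.le]
  have hd : ∀ s ∈ Ioi (0:ℝ), HasDerivWithinAt (fun s : ℝ => √(z ^ 2 + s ^ 2)) (s / √(z ^ 2 + s ^ 2)) (Ioi 0) s := by
    intro s hs
    have hs : 0 < s := hs
    apply HasDerivAt.hasDerivWithinAt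
    have h1 : HasDerivAt (fun s : ℝ => z ^ 2 + s ^ 2) (2 * s) s := by
      simpa using (hasDerivAt_pow 2 s).const_add (z ^ 2)
    refine (h1.sqrt (by positivity)).congr_deriv ?_
    rw [mul_div_mul_left _ _ two_ne_zero]
  have hinj : InjOn (fun s : ℝ => √(z ^ 2 + s ^ 2)) (Ioi 0) := by
    intro a ha b hb hab
    have ha : 0 < a := ha
    have hb : 0 < b := hb
    simp only at hab
    rw [Real.sqrt_inj (by positivity) (by positivity)] at hab
    nlinarith
  rw [← himg, lintegral_image_eq_lintegral_abs_deriv_mul measurableSet_Ioi hd hinj]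
  apply setLIntegral_congr_fun measurableSet_Ioi
  intro s hs
  have hs : 0 < s := hs
  simp only
  rw [← mul_assoc, ← ENNReal.ofReal_mul (abs_nonneg _)]
  congr 2
  rw [abs_of_nonneg (by positivity)]
  have : √(z ^ 2 + s ^ 2) ≠ 0 := by positivity
  field_simp

lemma arch (f : ℝ × ℝ → ℝ≥0∞) (hf : Measurable f) :
    ∫⁻ y : E3, f (‖y‖, y 0) =
      ∫⁻ t in Ioi (0:ℝ), ENNReal.ofReal (2 * π * t) * ∫⁻ z in Ioo (-t) t, f (t, z) := by
  rw [arch1 f hf]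
  have h1 : ∀ z : ℝ, ∫⁻ p : ℝ × ℝ, f (√(z ^ 2 + (p.1 ^ 2 + p.2 ^ 2)), z) =
      ∫⁻ t, (Ioi |z|).indicator (fun t => ENNReal.ofReal (2 * π * t) * f (t, z)) t := by
    intro z
    rw [arch2 (fun w => f (√(z ^ 2 + w), z)) (by fun_prop), arch3 z (fun t => f (t, z)),
      lintegral_indicator measurableSet_Ioi]
  simp_rw [h1]
  have hm : Measurable (fun q : ℝ × ℝ => (Ioi |q.1|).indicator (fun t => ENNReal.ofReal (2 * π * t) * f (t, q.1)) q.2) := by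
    have : (fun q : ℝ × ℝ => (Ioi |q.1|).indicator (fun t => ENNReal.ofReal (2 * π * t) * f (t, q.1)) q.2)
      = {q : ℝ × ℝ | |q.1| < q.2}.indicator (fun q => ENNReal.ofReal (2 * π * q.2) * f (q.2, q.1)) := by
      ext q; simp [indicator]
    rw [this]
    apply Measurable.indicator (by fun_prop)
    exact measurableSet_lt (by fun_prop) (by fun_prop)
  rw [lintegral_lintegral_swap hm.aemeasurable, ← lintegral_indicator measurableSet_Ioi]
  apply lintegral_congr
  intro t
  rw [indicator_apply]
  split_ifs with ht
  · rw [← lintegral_const_mul _ (by fun_prop), ← lintegral_indicator measurableSet_Ioo]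
    apply lintegral_congr
    intro z
    simp only [indicator, mem_Ioi, mem_Ioo, abs_lt]
  · have : ∀ z : ℝ, (Ioi |z|).indicator (fun t => ENNReal.ofReal (2 * π * t) * f (t, z)) t = 0 := by
      intro z
      rw [indicator_of_notMem]
      intro h
      exact ht ((abs_nonneg z).trans_lt h)
    simp [this]

lemma inner_int (r t : ℝ) (hr : 0 ≤ r) (ht : 0 < t) (hrt : r ≠ t) :
    ∫⁻ z in Ioo (-t) t, ENNReal.ofReal (1 / √(r ^ 2 + t ^ 2 - 2 * r * z)) =
      ENNReal.ofReal (2 * t / max r t) := by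
  have hpos : ∀ z ∈ Icc (-t) t, 0 < r ^ 2 + t ^ 2 - 2 * r * z := by
    intro z hz
    have : 0 < (r - t) ^ 2 := by have := sub_ne_zero.2 hrt; positivity
    nlinarith [hz.1, hz.2, mul_nonneg hr (sub_nonneg.2 hz.2)]
  have hcont : ContinuousOn (fun z => 1 / √(r ^ 2 + t ^ 2 - 2 * r * z)) (Icc (-t) t) := by
    apply ContinuousOn.div (by fun_prop) (by fun_prop)
    intro z hz
    exact (Real.sqrt_pos.2 (hpos z hz)).ne'
  have hint : IntervalIntegrable (fun z => 1 / √(r ^ 2 + t ^ 2 - 2 * r * z)) volume (-t) t := by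
    apply ContinuousOn.intervalIntegrable
    rwa [uIcc_of_le (by linarith)]
  rw [setLIntegral_congr Ioo_ae_eq_Ioc, ← ofReal_integral_eq_lintegral_ofReal]
  rotate_left
  · exact (intervalIntegrable_iff_integrableOn_Ioc_of_le (by linarith)).1 hint
  · exact Eventually.of_forall fun z => by positivity
  rw [← intervalIntegral.integral_of_le (by linarith)]
  congr 1
  rcases hr.eq_or_lt with h0 | h0
  · subst h0
    simp [Real.sqrt_sq ht.le, max_eq_right ht.le]
    ring
  · have hd : ∀ z ∈ uIcc (-t) t, HasDerivAt (fun z => - √(r ^ 2 + t ^ 2 - 2 * r * z) / r)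
        (1 / √(r ^ 2 + t ^ 2 - 2 * r * z)) z := by
      intro z hz
      rw [uIcc_of_le (by linarith)] at hz
      have h1 : HasDerivAt (fun z : ℝ => r ^ 2 + t ^ 2 - 2 * r * z) (-(2 * r)) z := by
        simpa using ((hasDerivAt_id z).const_mul (2 * r)).const_sub (r ^ 2 + t ^ 2)
      have h2 := ((h1.sqrt (hpos z hz).ne').neg).div_const r
      refine HasDerivAt.congr_deriv h2 ?_
      have := (Real.sqrt_pos.2 (hpos z hz)).ne'
      
      generalize √(r ^ 2 + t ^ 2 - 2 * r * z) = w at *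
      field_simp
    rw [intervalIntegral.integral_eq_sub_of_hasDerivAt hd hint]
    have e1 : r ^ 2 + t ^ 2 - 2 * r * t = (r - t) ^ 2 := by ring
    have e2 : r ^ 2 + t ^ 2 - 2 * r * -t = (r + t) ^ 2 := by ring
    rw [e1, e2, Real.sqrt_sq_eq_abs, Real.sqrt_sq (by linarith)]
    rcases le_total r t with h | h
    · rw [max_eq_right h, abs_of_nonpos (by linarith)]; field_simp; ring
    · rw [max_eq_left h, abs_of_nonneg (by linarith)]; field_simp; ring

lemma norm_sub_e0 (r : ℝ) (y : E3) : ‖r • e0v - y‖ = √(r ^ 2 + ‖y‖ ^ 2 - 2 * r * y 0) := by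
  rw [← Real.sqrt_sq (norm_nonneg (r • e0v - y)), norm_sub_sq_real]
  congr 1
  simp [norm_smul, inner_smul_left, e0v, EuclideanSpace.inner_single_left]
  ring

lemma shell_lint (r : ℝ) (hr : 0 ≤ r) (g : ℝ → ℝ≥0∞) (hg : Measurable g) :
    ∫⁻ y : E3, ENNReal.ofReal (1 / (4 * π * ‖r • e0v - y‖)) * g ‖y‖ =
      ∫⁻ t in Ioi (0:ℝ), ENNReal.ofReal (t ^ 2 / max r t) * g t := by
  have := arch (fun q => ENNReal.ofReal (1 / (4 * π * √(r ^ 2 + q.1 ^ 2 - 2 * r * q.2))) * g q.1)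
    (by fun_prop)
  simp only at this
  simp_rw [norm_sub_e0]
  rw [this]
  have hne : ∀ᵐ t ∂(volume.restrict (Ioi (0:ℝ))), t ≠ r := by
    apply ae_restrict_of_ae
    simp [ae_iff]
  apply lintegral_congr_ae
  filter_upwards [hne, ae_restrict_mem measurableSet_Ioi] with t htr ht
  have ht : 0 < t := ht
  rw [lintegral_mul_const _ (by fun_prop)]
  have h1 : ∀ z : ℝ, ENNReal.ofReal (1 / (4 * π * √(r ^ 2 + t ^ 2 - 2 * r * z))) =
      ENNReal.ofReal (1 / (4 * π)) * ENNReal.ofReal (1 / √(r ^ 2 + t ^ 2 - 2 * r * z)) := by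
    intro z
    rw [← ENNReal.ofReal_mul (by positivity)]
    congr 1
    rw [one_div_mul_one_div]
  simp_rw [h1]
  rw [lintegral_const_mul _ (by fun_prop), inner_int r t hr ht htr.symm, ← mul_assoc,
    ← ENNReal.ofReal_mul (by positivity), ← ENNReal.ofReal_mul (by positivity)]
  congr 2
  have : 0 < max r t := lt_max_of_lt_right ht
  field_simp
  norm_num

lemma shell_int (r : ℝ) (hr : 0 ≤ r) (P : ℝ → ℝ) (hP : Continuous P) :
    ∫ y : E3, P ‖y‖ / (4 * π * ‖r • e0v - y‖) =
      ∫ t in Ioi (0:ℝ), t ^ 2 / max r t * P t := by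
  have key : Measure.map (fun y : E3 => ‖y‖)
      (volume.withDensity (fun y : E3 => ENNReal.ofReal (1 / (4 * π * ‖r • e0v - y‖)))) =
      (volume.restrict (Ioi (0:ℝ))).withDensity (fun t => ENNReal.ofReal (t ^ 2 / max r t)) := by
    ext s hs
    rw [Measure.map_apply (by fun_prop) hs, withDensity_apply _ (measurable_norm hs),
      withDensity_apply _ hs, ← lintegral_indicator (measurable_norm hs), ← lintegral_indicator hs]
    have := shell_lint r hr (s.indicator 1) (measurable_one.indicator hs)
    convert this using 1
    · apply lintegral_congr
      intro y
      by_cases hy : ‖y‖ ∈ s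
      · rw [indicator_of_mem (by exact hy), indicator_of_mem hy]; simp
      · rw [indicator_of_notMem (by exact hy), indicator_of_notMem hy]; simp
    · apply lintegral_congr
      intro y
      simp [indicator]
  have h1 : ∫ y : E3, P ‖y‖ / (4 * π * ‖r • e0v - y‖) =
      ∫ y : E3, P ‖y‖ ∂(volume.withDensity (fun y : E3 => ENNReal.ofReal (1 / (4 * π * ‖r • e0v - y‖)))) := by
    rw [integral_withDensity_eq_integral_toReal_smul (by fun_prop) (Eventually.of_forall fun _ => ENNReal.ofReal_lt_top)]
    apply integral_congr_ae (Eventually.of_forall fun y => ?_)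
    simp only [smul_eq_mul]
    rw [ENNReal.toReal_ofReal (by positivity)]
    ring
  rw [h1]
  have h2 := integral_map (φ := fun y : E3 => ‖y‖) (μ := (volume.withDensity (fun y : E3 => ENNReal.ofReal (1 / (4 * π * ‖r • e0v - y‖))))) (f := P) (by fun_prop) hP.aestronglyMeasurable
  rw [← h2, key, integral_withDensity_eq_integral_toReal_smul (by fun_prop) (Eventually.of_forall fun _ => ENNReal.ofReal_lt_top)]
  apply setIntegral_congr_fun measurableSet_Ioi
  intro t ht
  have ht : 0 < t := ht
  simp only [smul_eq_mul]
  rw [ENNReal.toReal_ofReal (by positivity)]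



def kf (P : ℝ → ℝ) (r : ℝ) : ℝ := ∫ t in (0:ℝ)..1, t ^ 2 * P (t * r)
def k1f (P : ℝ → ℝ) (r : ℝ) : ℝ := ∫ t in (0:ℝ)..1, t * P (t * r)

lemma kf_cont {P : ℝ → ℝ} (hP : Continuous P) : Continuous (kf P) := by
  unfold kf
  apply intervalIntegral.continuous_parametric_intervalIntegral_of_continuous'
  fun_prop

lemma k1f_cont {P : ℝ → ℝ} (hP : Continuous P) : Continuous (k1f P) := by
  unfold k1f
  apply intervalIntegral.continuous_parametric_intervalIntegral_of_continuous'
  fun_prop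

lemma kf_eq (P : ℝ → ℝ) {r : ℝ} (hr : 0 < r) : kf P r = (∫ t in (0:ℝ)..r, t ^ 2 * P t) / r ^ 3 := by
  have := intervalIntegral.integral_comp_mul_right (a := 0) (b := 1) (fun t => t ^ 2 * P t) hr.ne'
  simp only [zero_mul, one_mul, smul_eq_mul] at this
  have h2 : ∫ t in (0:ℝ)..1, (t * r) ^ 2 * P (t * r) = r ^ 2 * kf P r := by
    unfold kf
    rw [← intervalIntegral.integral_const_mul]
    congr 1; ext t; ring
  rw [h2] at this
  field_simp at this ⊢
  linarith

lemma k1f_eq (P : ℝ → ℝ) {r : ℝ} (hr : 0 < r) : k1f P r = (∫ t in (0:ℝ)..r, t * P t) / r ^ 2 := by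
  have := intervalIntegral.integral_comp_mul_right (a := 0) (b := 1) (fun t => t * P t) hr.ne'
  simp only [zero_mul, one_mul, smul_eq_mul] at this
  have h2 : ∫ t in (0:ℝ)..1, (t * r) * P (t * r) = r * k1f P r := by
    unfold k1f
    rw [← intervalIntegral.integral_const_mul]
    congr 1; ext t; ring
  rw [h2] at this
  field_simp at this ⊢
  linarith

lemma ftc_aux {g : ℝ → ℝ} (hg : Continuous g) (r : ℝ) :
    HasDerivAt (fun r => ∫ t in (0:ℝ)..r, g t) (g r) r :=
  intervalIntegral.integral_hasDerivAt_right (hg.intervalIntegrable _ _)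
    hg.aestronglyMeasurable.stronglyMeasurableAtFilter hg.continuousAt

lemma kf_deriv {P : ℝ → ℝ} (hP : Continuous P) {r : ℝ} (hr : 0 < r) :
    HasDerivAt (fun r => r ^ 2 * kf P r) (r * (P r - kf P r)) r := by
  have h1 := ftc_aux (g := fun t => t ^ 2 * P t) (by fun_prop) r
  have h2 := h1.div (hasDerivAt_id r) hr.ne'
  refine (h2.congr_of_eventuallyEq ?_).congr_deriv ?_
  · filter_upwards [eventually_gt_nhds hr] with s hs
    rw [kf_eq P hs]
    simp only [Pi.div_apply, id]
    field_simp
  · rw [kf_eq P hr]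
    simp only [id]
    field_simp

lemma pot_deriv {P : ℝ → ℝ} (hP : Continuous P) {r : ℝ} (hr : 0 < r) :
    HasDerivAt (fun r => r ^ 2 * (k1f P r - kf P r)) (r * kf P r) r := by
  have h1 := ftc_aux (g := fun t => t * P t) (by fun_prop) r
  have h2 := h1.sub (kf_deriv hP hr)
  refine (h2.congr_of_eventuallyEq ?_).congr_deriv ?_
  · filter_upwards [eventually_gt_nhds hr] with s hs
    simp only [Pi.sub_apply]
    rw [k1f_eq P hs]
    field_simp
  · ring

lemma rad_fderiv {κ d : ℝ → ℝ} (hκ : Continuous κ)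
    (hd : ∀ r, 0 < r → HasDerivAt (fun r => r ^ 2 * κ r) (r * d r) r) (x : E3) :
    HasFDerivAt (fun x : E3 => ‖x‖ ^ 2 * κ ‖x‖) (d ‖x‖ • innerSL ℝ x) x := by
  by_cases hx : x = 0
  · subst hx
    simp only [map_zero, smul_zero]
    rw [hasFDerivAt_iff_isLittleO_nhds_zero]
    simp only [zero_add, norm_zero, zero_apply, sub_zero]
    have h1 : (fun h : E3 => ‖h‖ * κ ‖h‖) =o[𝓝 0] (fun _ => (1:ℝ)) := by
      rw [Asymptotics.isLittleO_one_iff]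
      have : Continuous (fun h : E3 => ‖h‖ * κ ‖h‖) := by fun_prop
      simpa using this.tendsto 0
    have h2 := (Asymptotics.isBigO_refl (fun h : E3 => ‖h‖) (𝓝 0)).mul_isLittleO h1
    have h3 : (fun h : E3 => ‖h‖ * (‖h‖ * κ ‖h‖)) =o[𝓝 0] (fun h : E3 => h) := by
      rw [← Asymptotics.isLittleO_norm_right]; simpa using h2
    refine h3.congr_left ?_
    intro h; ring
  · have hx' : 0 < ‖x‖ := norm_pos_iff.2 hx
    have hsq : HasFDerivAt (fun x : E3 => ‖x‖ ^ 2) (2 • innerSL ℝ x) x := (hasStrictFDerivAt_norm_sq x).hasFDerivAt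
    have hn := hsq.sqrt (by positivity)
    simp only [Real.sqrt_sq (norm_nonneg _)] at hn
    have := (hd _ hx').comp_hasFDerivAt x hn
    refine this.congr_fderiv ?_
    ext v
    simp
    field_simp

section
variable {f : Phase → ℝ}

def Prad (f : Phase → ℝ) (r : ℝ) : ℝ := rhoF f (r • e0v)

lemma Prad_cont (hc : Continuous f) (hs : HasCompactSupport f) : Continuous (Prad f) := by
  have := rhoF_cont hc hs
  unfold Prad
  fun_prop

lemma phiF_rot (hs : SphSym f) (x : E3) : phiF f x = phiF f (‖x‖ • e0v) := by
  obtain ⟨R, h1, h2⟩ := exists_rot x (‖x‖ • e0v) (by simp [norm_smul])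
  rw [← h2]
  unfold phiF
  rw [← R.measurePreserving.integral_comp R.toHomeomorph.measurableEmbedding (fun y => rhoF f y / (4 * π * ‖R x - y‖))]
  congr 1
  apply integral_congr_ae (Eventually.of_forall fun y => ?_)
  beta_reduce
  rw [rhoF_rot hs R h1, ← map_sub, R.norm_map]

lemma Prad_supp (hs : HasCompactSupport f) : HasCompactSupport (Prad f) := by
  have h : Isometry (fun r : ℝ => r • e0v) := by
    apply Isometry.of_dist_eq
    intro a b
    rw [dist_eq_norm, ← sub_smul, norm_smul, norm_e0v, mul_one, dist_eq_norm]
  exact (rhoF_supp hs).comp_isClosedEmbedding h.isClosedEmbedding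

lemma phiF_formula (hc : Continuous f) (hcs : HasCompactSupport f) (hs : SphSym f) :
    ∃ c : ℝ, ∀ x, phiF f x = c + ‖x‖ ^ 2 * (k1f (Prad f) ‖x‖ - kf (Prad f) ‖x‖) := by
  have hP := Prad_cont hc hcs
  set P := Prad f with hPdef
  refine ⟨- ∫ t in Ioi (0:ℝ), t * P t, fun x => ?_⟩
  rw [phiF_rot hs]
  unfold phiF
  have h0 := shell_int ‖x‖ (norm_nonneg x) P hP
  have e0 : ∀ y : E3, rhoF f y = P ‖y‖ := fun y => rhoF_radial hs y
  simp only [e0]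
  rw [h0]
  have hPs : HasCompactSupport P := Prad_supp hcs
  have hx0 := norm_nonneg x
  clear h0
  generalize ‖x‖ = r at *
  have hint : Integrable (fun t => t * P t) := by
    apply Continuous.integrable_of_hasCompactSupport (by fun_prop)
    exact hPs.mul_left
  have hint2 : Integrable (fun t => t ^ 2 / max r t * P t) (volume.restrict (Ioi 0)) := by
    refine Integrable.mono (hint.restrict (s := Ioi 0)) ?_ ?_
    · exact Measurable.aestronglyMeasurable (by fun_prop)
    · filter_upwards [ae_restrict_mem measurableSet_Ioi] with t ht
      have ht : 0 < t := ht
      rw [norm_mul, norm_mul]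
      gcongr
      rw [Real.norm_of_nonneg (by positivity), Real.norm_of_nonneg ht.le, div_le_iff₀ (lt_max_of_lt_right ht)]
      nlinarith [le_max_right r t]
  rcases hx0.eq_or_lt with h | hr
  · subst h
    simp only [ne_eq, OfNat.ofNat_ne_zero, not_false_eq_true, zero_pow, zero_mul, add_zero]
    congr 1
    apply setIntegral_congr_fun measurableSet_Ioi
    intro t ht
    have ht : 0 < t := ht
    simp only [max_eq_right ht.le]
    field_simp
  · have key : (∫ t in Ioi (0:ℝ), t * P t) - ∫ t in Ioi (0:ℝ), t ^ 2 / max r t * P t =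
        ∫ t in (0:ℝ)..r, (t * P t - (t ^ 2 * P t) / r) := by
      rw [← integral_sub hint.integrableOn hint2, intervalIntegral.integral_of_le hr.le]
      symm
      rw [← integral_indicator measurableSet_Ioc, ← integral_indicator measurableSet_Ioi]
      congr 1
      ext t
      by_cases ht : 0 < t
      · by_cases htr : t ≤ r
        · rw [indicator_of_mem (show t ∈ Ioc 0 r from ⟨ht, htr⟩), indicator_of_mem (show t ∈ Ioi 0 from ht),
            max_eq_left htr]
          ring
        · rw [indicator_of_notMem (fun h => htr h.2), indicator_of_mem (show t ∈ Ioi 0 from ht),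
            max_eq_right (le_of_not_ge htr)]
          field_simp
          ring
      · rw [indicator_of_notMem (fun h => ht h.1), indicator_of_notMem (show t ∉ Ioi 0 from ht)]
    rw [intervalIntegral.integral_sub (hint.intervalIntegrable) (Continuous.intervalIntegrable (by fun_prop) _ _),
      intervalIntegral.integral_div] at key
    rw [kf_eq P hr, k1f_eq P hr]
    field_simp
    field_simp at key
    linarith

lemma phiF_hasFDerivAt (hc : Continuous f) (hcs : HasCompactSupport f) (hs : SphSym f) (x : E3) :
    HasFDerivAt (phiF f) (kf (Prad f) ‖x‖ • innerSL ℝ x) x := by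
  obtain ⟨c, hcf⟩ := phiF_formula hc hcs hs
  have hP := Prad_cont hc hcs
  have := (rad_fderiv (κ := fun r => k1f (Prad f) r - kf (Prad f) r) (d := kf (Prad f))
    ((k1f_cont hP).sub (kf_cont hP)) (fun r hr => pot_deriv hP hr) x).const_add c
  exact this.congr_of_eventuallyEq (Eventually.of_forall hcf)

lemma gradPhi_eq (hc : Continuous f) (hcs : HasCompactSupport f) (hs : SphSym f) (x : E3) :
    gradPhi f x = kf (Prad f) ‖x‖ • x := by
  unfold gradPhi
  apply HasGradientAt.gradient
  rw [hasGradientAt_iff_hasFDerivAt]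
  refine (phiF_hasFDerivAt hc hcs hs x).congr_fderiv ?_
  ext v
  simp [inner_smul_left]

lemma phiRad_deriv (hc : Continuous f) (hcs : HasCompactSupport f) (hs : SphSym f) {r : ℝ} (hr : 0 < r) :
    deriv (phiRad f) r / r = kf (Prad f) r := by
  have h1 : HasDerivAt (fun r : ℝ => r • e0v) e0v r := by
    simpa using (hasDerivAt_id r).smul_const e0v
  have h2 := (phiF_hasFDerivAt hc hcs hs (r • e0v)).comp_hasDerivAt r h1
  have h3 : deriv (phiRad f) r = _ := h2.deriv
  rw [h3]
  simp [norm_smul, inner_smul_left, abs_of_pos hr]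
  field_simp
end



lemma ibp_one {u u' : E3 → ℝ} {e : E3} (hu : Continuous u) (hus : HasCompactSupport u)
    (hu' : Integrable u') (hd : ∀ x, HasLineDerivAt ℝ u (u' x) x e) : ∫ x, u' x = 0 := by
  have := integral_bilinear_hasLineDerivAt_right_eq_neg_left_of_integrable (μ := (volume : Measure E3))
    (f := fun _ => (1:ℝ)) (f' := fun _ => (0:ℝ)) (g := u) (g' := u') (v := e)
    (B := ContinuousLinearMap.mul ℝ ℝ) (by simp) (by simpa using hu')
    (by simpa using hu.integrable_of_hasCompactSupport hus)
    (fun x _ => by simpa using (hasFDerivAt_const (1:ℝ) x).hasLineDerivAt e) (fun x _ => hd x)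
  simpa using this

lemma slice_supp1 {h : Phase → ℝ} (hs : HasCompactSupport h) (v : E3) :
    HasCompactSupport (fun x => h (x, v)) := by
  apply HasCompactSupport.intro (hs.image continuous_fst)
  intro x hx
  by_contra h'
  exact hx ⟨(x, v), subset_tsupport _ h', rfl⟩

lemma slice_supp2 {h : Phase → ℝ} (hs : HasCompactSupport h) (x : E3) :
    HasCompactSupport (fun v => h (x, v)) := by
  apply HasCompactSupport.intro (hs.image continuous_snd)
  intro v hv
  by_contra h'
  exact hv ⟨(x, v), subset_tsupport _ h', rfl⟩

lemma slice_line1 {h : Phase → ℝ} (hd : Differentiable ℝ h) (x v e : E3) :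
    HasLineDerivAt ℝ (fun x => h (x, v)) (fderiv ℝ h (x, v) (e, 0)) x e := by
  have h1 := (hd (x, v)).hasFDerivAt.hasLineDerivAt (e, 0)
  unfold HasLineDerivAt at h1 ⊢
  simpa using h1

lemma slice_line2 {h : Phase → ℝ} (hd : Differentiable ℝ h) (x v e : E3) :
    HasLineDerivAt ℝ (fun v => h (x, v)) (fderiv ℝ h (x, v) (0, e)) v e := by
  have h1 := (hd (x, v)).hasFDerivAt.hasLineDerivAt (0, e)
  unfold HasLineDerivAt at h1 ⊢
  simpa using h1

lemma fderiv_app_supp {h : Phase → ℝ} (hs : HasCompactSupport h) (c : Phase → Phase) :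
    HasCompactSupport (fun z => fderiv ℝ h z (c z)) := by
  refine (hs.fderiv (𝕜 := ℝ)).mono ?_
  intro z hz
  rw [Function.mem_support] at hz ⊢
  intro h0
  apply hz
  simp [h0]

lemma fderiv_app_cont {h : Phase → ℝ} (hd : ContDiff ℝ 1 h) {c : Phase → Phase} (hc : Continuous c) :
    Continuous (fun z => fderiv ℝ h z (c z)) :=
  (hd.continuous_fderiv one_ne_zero).clm_apply hc

lemma int_v_part {h : Phase → ℝ} (hd : ContDiff ℝ 1 h) (hs : HasCompactSupport h) (x e : E3) :
    ∫ v, fderiv ℝ h (x, v) (0, e) = 0 := by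
  apply ibp_one (u := fun v => h (x, v)) (e := e)
  · have := hd.continuous; fun_prop
  · exact slice_supp2 hs x
  · apply Continuous.integrable_of_hasCompactSupport
    · exact (fderiv_app_cont hd (c := fun _ => (0, e)) continuous_const).comp (by fun_prop : Continuous fun v : E3 => (x, v))
    · exact slice_supp2 (fderiv_app_supp hs (fun _ => (0, e))) x
  · exact fun v => slice_line2 (hd.differentiable one_ne_zero) x v e

lemma int_x_part {h : Phase → ℝ} (hd : ContDiff ℝ 1 h) (hs : HasCompactSupport h) (v e : E3) :
    ∫ x, fderiv ℝ h (x, v) (e, 0) = 0 := by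
  apply ibp_one (u := fun x => h (x, v)) (e := e)
  · have := hd.continuous; fun_prop
  · exact slice_supp1 hs v
  · apply Continuous.integrable_of_hasCompactSupport
    · exact (fderiv_app_cont hd (c := fun _ => (e, 0)) continuous_const).comp (by fun_prop : Continuous fun x : E3 => (x, v))
    · exact slice_supp1 (fderiv_app_supp hs (fun _ => (e, 0))) v
  · exact fun x => slice_line1 (hd.differentiable one_ne_zero) x v e

lemma int_T_zero {h : Phase → ℝ} (hd : ContDiff ℝ 1 h) (hs : HasCompactSupport h) {b : E3 → E3}
    (hb : Continuous b) : ∫ z : Phase, fderiv ℝ h z (z.2, b z.1) = 0 := by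
  have h1 : Integrable (fun z : Phase => fderiv ℝ h z (z.2, 0)) :=
    (fderiv_app_cont hd (by fun_prop)).integrable_of_hasCompactSupport (fderiv_app_supp hs _)
  have h2 : Integrable (fun z : Phase => fderiv ℝ h z (0, b z.1)) :=
    (fderiv_app_cont hd (by fun_prop)).integrable_of_hasCompactSupport (fderiv_app_supp hs _)
  have : ∀ z : Phase, fderiv ℝ h z (z.2, b z.1) = fderiv ℝ h z (z.2, 0) + fderiv ℝ h z (0, b z.1) := by
    intro z
    rw [← map_add]; simp
  simp_rw [this]
  rw [integral_add h1 h2]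
  have e1 : ∫ z : Phase, fderiv ℝ h z (z.2, 0) = 0 := by
    rw [Measure.volume_eq_prod] at h1 ⊢
    rw [integral_prod_symm _ h1]
    simp [int_x_part hd hs]
  have e2 : ∫ z : Phase, fderiv ℝ h z (0, b z.1) = 0 := by
    rw [Measure.volume_eq_prod] at h2 ⊢
    rw [integral_prod _ h2]
    simp [int_v_part hd hs]
  rw [e1, e2, add_zero]

section
variable {Q : Phase → ℝ}

lemma ell_hasFDerivAt (z : Phase) : ∃ L : Phase →L[ℝ] ℝ, HasFDerivAt ellOf L z ∧
    ∀ c : ℝ, L (z.2, -(c • z.1)) = 0 := by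
  have h1 : HasFDerivAt (fun z : Phase => z.1) (ContinuousLinearMap.fst ℝ E3 E3) z := hasFDerivAt_fst
  have h2 : HasFDerivAt (fun z : Phase => z.2) (ContinuousLinearMap.snd ℝ E3 E3) z := hasFDerivAt_snd
  have := ((h1.norm_sq).mul h2.norm_sq).sub ((h1.inner ℝ h2).pow 2)
  refine ⟨_, this, ?_⟩
  intro c
  simp [inner_smul_left, inner_smul_right, real_inner_self_eq_norm_sq, real_inner_comm z.1 z.2]
  ring

lemma ell_contDiff : ContDiff ℝ 1 ellOf := by
  unfold ellOf
  have h1 : ContDiff ℝ 1 (fun z : Phase => z.1) := contDiff_fst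
  have h2 : ContDiff ℝ 1 (fun z : Phase => z.2) := contDiff_snd
  exact ((h1.norm_sq ℝ).mul (h2.norm_sq ℝ)).sub ((h1.inner ℝ h2).pow 2)

lemma ell_nonneg (z : Phase) : 0 ≤ ellOf z := by
  unfold ellOf
  have := abs_real_inner_le_norm z.1 z.2
  have h2 := pow_le_pow_left₀ (abs_nonneg _) this 2
  rw [sq_abs, mul_pow] at h2
  linarith

lemma phi_contDiff (hc : Continuous Q) (hcs : HasCompactSupport Q) (hs : SphSym Q) :
    ContDiff ℝ 1 (phiF Q) := by
  rw [contDiff_one_iff_hasFDerivAt]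
  refine ⟨_, ?_, phiF_hasFDerivAt hc hcs hs⟩
  have := kf_cont (Prad_cont hc hcs)
  fun_prop

lemma micro_contDiff (hc : Continuous Q) (hcs : HasCompactSupport Q) (hs : SphSym Q) :
    ContDiff ℝ 1 (microE Q) := by
  unfold microE
  have h2 : ContDiff ℝ 1 (fun z : Phase => z.2) := contDiff_snd
  exact ((h2.norm_sq ℝ).div_const 2).add ((phi_contDiff hc hcs hs).comp contDiff_fst)

lemma micro_T (hc : Continuous Q) (hcs : HasCompactSupport Q) (hs : SphSym Q) (z : Phase) :
    fderiv ℝ (microE Q) z (z.2, -(kf (Prad Q) ‖z.1‖ • z.1)) = 0 := by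
  have h2 : HasFDerivAt (fun z : Phase => z.2) (ContinuousLinearMap.snd ℝ E3 E3) z := hasFDerivAt_snd
  have h1 : HasFDerivAt (fun z : Phase => z.1) (ContinuousLinearMap.fst ℝ E3 E3) z := hasFDerivAt_fst
  have := (h2.norm_sq.const_mul (1/2)).add ((phiF_hasFDerivAt hc hcs hs z.1).comp z h1)
  have h3 : HasFDerivAt (microE Q) _ z := this.congr_of_eventuallyEq
    (Eventually.of_forall fun y => by simp [microE]; ring)
  rw [h3.fderiv]
  simp [inner_smul_right, real_inner_comm z.1 z.2]

lemma inv_T (hc : Continuous Q) (hcs : HasCompactSupport Q) (hs : SphSym Q) {G : ℝ × ℝ → ℝ}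
    (hG : ContDiff ℝ 1 G) (z : Phase) :
    fderiv ℝ (fun z => G (microE Q z, ellOf z)) z (z.2, -(kf (Prad Q) ‖z.1‖ • z.1)) = 0 := by
  have h1 := ((micro_contDiff hc hcs hs).differentiable one_ne_zero z).hasFDerivAt
  obtain ⟨L, h2, h3⟩ := ell_hasFDerivAt z
  have h4 := (hG.differentiable one_ne_zero (microE Q z, ellOf z)).hasFDerivAt.comp z (h1.prodMk h2)
  have h5 : HasFDerivAt (fun z => G (microE Q z, ellOf z)) _ z := h4
  rw [h5.fderiv]
  simp only [ContinuousLinearMap.comp_apply, ContinuousLinearMap.prod_apply, h3, micro_T hc hcs hs]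
  exact map_zero _

end



section
variable {Q : Phase → ℝ} {F : ℝ → ℝ → ℝ} {e₀ : ℝ}

def Fe (F : ℝ → ℝ → ℝ) (p : ℝ × ℝ) : ℝ := deriv (fun e => F e p.2) p.1

lemma Fe_cont (hQ : AssumptionA Q F e₀) :
    ContinuousOn (Fe F) {p : ℝ × ℝ | 0 ≤ p.2 ∧ 0 < F p.1 p.2} := by
  set S := {p : ℝ × ℝ | 0 ≤ p.2 ∧ 0 < F p.1 p.2} with hS
  obtain ⟨U, hU, hUeq⟩ := (continuousOn_iff'.1 hQ.Fcont) (Ioi 0) isOpen_Ioi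
  have hSU : S = {p : ℝ × ℝ | 0 ≤ p.2} ∩ U := by
    ext p
    have := Set.ext_iff.1 hUeq p
    simp only [mem_inter_iff, mem_preimage, mem_Ioi, mem_ofPred_eq] at this
    simp only [hS, mem_ofPred_eq, mem_inter_iff]
    tauto
  have hud : UniqueDiffOn ℝ S := by
    rw [hSU]
    apply UniqueDiffOn.inter _ hU
    apply uniqueDiffOn_convex
    · exact (convex_Ici (0:ℝ)).linear_preimage (LinearMap.snd ℝ ℝ ℝ)
    · refine ⟨(0, 1), mem_interior.2 ⟨{p : ℝ × ℝ | 0 < p.2}, fun p hp => (le_of_lt (show 0 < p.2 from hp) : 0 ≤ p.2), ?_, by simp⟩⟩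
      exact isOpen_lt continuous_const continuous_snd
  have h1 : ContinuousOn (fun p => fderivWithin ℝ (fun p : ℝ × ℝ => F p.1 p.2) S p ((1:ℝ), (0:ℝ))) S :=
    (hQ.FC1.continuousOn_fderivWithin hud le_rfl).clm_apply continuousOn_const
  refine h1.congr ?_
  intro p hp
  have hd := ((hQ.FC1.differentiableOn one_ne_zero) p hp).hasFDerivWithinAt
  have hc : HasDerivAt (fun e : ℝ => (e, p.2)) ((1:ℝ), (0:ℝ)) p.1 :=
    (hasDerivAt_id p.1).prodMk (hasDerivAt_const p.1 p.2)
  have hpU : p ∈ U := by rw [hSU] at hp; exact hp.2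
  have hmaps : ∀ᶠ e in 𝓝 p.1, (e, p.2) ∈ S := by
    have : ContinuousAt (fun e : ℝ => (e, p.2)) p.1 := by fun_prop
    filter_upwards [this.preimage_mem_nhds (hU.mem_nhds hpU)] with e he
    rw [hSU]
    exact ⟨hp.1, he⟩
  have := HasFDerivWithinAt.comp_hasDerivAt_of_eq p.1 hd hc hmaps rfl
  exact this.deriv

def wt (Q : Phase → ℝ) (F : ℝ → ℝ → ℝ) (z : Phase) : ℝ :=
  1 / |deriv (fun e => F e (ellOf z)) (microE Q z)|

lemma mem_S (hQ : AssumptionA Q F e₀) {z : Phase} (hz : 0 < Q z) :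
    (microE Q z, ellOf z) ∈ {p : ℝ × ℝ | 0 ≤ p.2 ∧ 0 < F p.1 p.2} := by
  refine ⟨ell_nonneg z, ?_⟩
  simp only
  rw [← hQ.eqF]; exact hz

lemma me_cont (hQ : AssumptionA Q F e₀) : Continuous (fun z => (microE Q z, ellOf z)) :=
  (micro_contDiff hQ.contQ hQ.cpt hQ.sph).continuous.prodMk ell_contDiff.continuous

lemma Fe_neg (hQ : AssumptionA Q F e₀) {p : ℝ × ℝ} (hp : p ∈ {p : ℝ × ℝ | 0 ≤ p.2 ∧ 0 < F p.1 p.2}) :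
    Fe F p < 0 := hQ.FeNeg _ _ hp.1 hp.2

lemma int_w_T (hQ : AssumptionA Q F e₀) {h : Phase → ℝ} (hd : ContDiff ℝ 1 h)
    (hs : HasCompactSupport h) (hsupp : tsupport h ⊆ {z | 0 < Q z}) :
    ∫ z : Phase, wt Q F z * fderiv ℝ h z (z.2, -(kf (Prad Q) ‖z.1‖ • z.1)) = 0 := by
  set S := {p : ℝ × ℝ | 0 ≤ p.2 ∧ 0 < F p.1 p.2} with hS
  set m : Phase → ℝ × ℝ := fun z => (microE Q z, ellOf z) with hm
  set Th : Phase → ℝ := fun z => fderiv ℝ h z (z.2, -(kf (Prad Q) ‖z.1‖ • z.1)) with hTh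
  have hb : Continuous (fun x : E3 => -(kf (Prad Q) ‖x‖ • x)) := by
    have := kf_cont (Prad_cont hQ.contQ hQ.cpt)
    fun_prop
  have hThc : Continuous Th := fderiv_app_cont hd (c := fun z => (z.2, -(kf (Prad Q) ‖z.1‖ • z.1)))
    (continuous_snd.prodMk (hb.comp continuous_fst))
  have hThs : HasCompactSupport Th := fderiv_app_supp hs _
  have hThi : Integrable Th := hThc.integrable_of_hasCompactSupport hThs
  have hTz : ∀ z, z ∉ tsupport h → Th z = 0 := by
    intro z hz
    have : fderiv ℝ h z = 0 := by
      by_contra h0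
      exact hz (tsupport_fderiv_subset ℝ (subset_tsupport _ h0))
    simp [hTh, this]
  have hmc : Continuous m := me_cont hQ
  set K' := m '' tsupport h with hK'
  have hK'c : IsCompact K' := hs.isCompact.image hmc
  have hK'S : K' ⊆ S := by
    rintro _ ⟨z, hz, rfl⟩
    exact mem_S hQ (hsupp hz)
  have hWc : ContinuousOn (fun p => 1 / |Fe F p|) K' := by
    apply ContinuousOn.div continuousOn_const ((Fe_cont hQ).mono hK'S).abs
    intro p hp
    exact abs_ne_zero.2 (Fe_neg hQ (hK'S hp)).ne
  obtain ⟨W, hW⟩ := ContinuousMap.exists_restrict_eq hK'c.isClosed ⟨_, hWc.domRestrict⟩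
  have hWw : ∀ z ∈ tsupport h, W (m z) = wt Q F z := by
    intro z hz
    have := DFunLike.congr_fun hW ⟨m z, ⟨z, hz, rfl⟩⟩
    exact this
  rw [← norm_eq_zero]
  apply le_antisymm _ (norm_nonneg _)
  apply le_of_forall_pos_le_add
  intro δ hδ
  set I := ∫ z, ‖Th z‖ with hI
  have hI0 : 0 ≤ I := integral_nonneg fun z => norm_nonneg _
  obtain ⟨G, hG, hGW, -⟩ := W.continuous.exists_contDiff_approx 1 (ε := fun _ => δ / (I + 1))
    continuous_const (fun _ => by positivity)
  have hG : ContDiff ℝ 1 G := hG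
  have hGm : ContDiff ℝ 1 (fun z => G (m z)) :=
    hG.comp ((micro_contDiff hQ.contQ hQ.cpt hQ.sph).prodMk ell_contDiff)
  have hz0 : ∫ z, G (m z) * Th z = 0 := by
    have := int_T_zero (h := fun z => G (m z) * h z) (hGm.mul hd) hs.mul_left hb
    rw [← this]
    congr 1
    ext z
    have h1 := (hGm.differentiable one_ne_zero z).hasFDerivAt
    have h2 := (hd.differentiable one_ne_zero z).hasFDerivAt
    have h3 := (h1.mul h2).fderiv
    have h4 := inv_T hQ.contQ hQ.cpt hQ.sph hG z
    have h5 : fderiv ℝ (fun z => G (m z)) z (z.2, -(kf (Prad Q) ‖z.1‖ • z.1)) = 0 := h4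
    have h3' : fderiv ℝ (fun z => G (m z) * h z) z = _ := h3
    rw [h3']
    simp only [add_apply, smul_apply, h5, smul_eq_mul, mul_zero, add_zero, hTh]
  have hGi : Integrable (fun z => G (m z) * Th z) :=
    (hGm.continuous.mul hThc).integrable_of_hasCompactSupport hThs.mul_left
  have hwT : (fun z => wt Q F z * Th z) = fun z => W (m z) * Th z := by
    ext z
    by_cases hz : z ∈ tsupport h
    · rw [hWw z hz]
    · rw [hTz z hz]; simp
  have hWi : Integrable (fun z => W (m z) * Th z) :=
    ((W.continuous.comp hmc).mul hThc).integrable_of_hasCompactSupport hThs.mul_left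
  have hwT' : ∫ z, wt Q F z * Th z = ∫ z, W (m z) * Th z := by rw [hwT]
  change ‖∫ z, wt Q F z * Th z‖ ≤ 0 + δ
  rw [zero_add, hwT', ← sub_zero (∫ z, W (m z) * Th z), ← hz0, ← integral_sub hWi hGi]
  calc ‖∫ z, (W (m z) * Th z - G (m z) * Th z)‖ ≤ ∫ z, δ / (I + 1) * ‖Th z‖ := by
        apply norm_integral_le_of_norm_le (hThi.norm.const_mul _)
        refine Eventually.of_forall fun z => ?_
        rw [← sub_mul, norm_mul]
        gcongr
        have := (hGW (m z)).le
        rwa [dist_comm, dist_eq_norm] at this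
    _ = δ / (I + 1) * I := integral_const_mul _ _
    _ ≤ δ := by
        rw [div_mul_eq_mul_div, div_le_iff₀ (by positivity)]
        nlinarith
end



lemma mixed_bound {ξ : Phase → ℝ} (hsm : ContDiff ℝ (⊤ : ℕ∞) ξ) (hc : HasCompactSupport ξ)
    (h0 : ∀ x v : E3, inner ℝ x v = 0 → ξ (x, v) = 0) :
    ∃ C : ℝ, 0 ≤ C ∧ ∀ z : Phase, |ξ z| ≤ C * |inner ℝ z.1 z.2| := by
  have hd : Differentiable ℝ ξ := hsm.differentiable (by simp)
  have h1 : ContDiff ℝ 1 (fderiv ℝ ξ) := (contDiff_infty.1 hsm 2).fderiv_right (m := 1) (by norm_num)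
  obtain ⟨M, hM⟩ := h1.lipschitzWith_of_hasCompactSupport (hc.fderiv (𝕜 := ℝ)) one_ne_zero
  refine ⟨M, M.2, ?_⟩
  rintro ⟨x, v⟩
  by_cases hx : x = 0
  · subst hx
    rw [h0 0 v (by simp)]; simp
  have hxp : 0 < ‖x‖ := norm_pos_iff.2 hx
  set n : E3 := ‖x‖⁻¹ • x with hn
  have hnn : ‖n‖ = 1 := by rw [hn, norm_smul, norm_inv, norm_norm]; field_simp
  have hxn : x = ‖x‖ • n := by rw [hn, smul_smul, mul_inv_cancel₀ hxp.ne', one_smul]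
  set t : ℝ := inner ℝ n v with ht
  set vp : E3 := v - t • n with hvp
  have hnvp : inner ℝ n vp = 0 := by
    rw [hvp, inner_sub_right, inner_smul_right, real_inner_self_eq_norm_sq, hnn]; simp [ht]
  have hline : ∀ (u : E3) (s : ℝ), HasDerivAt (fun s : ℝ => ξ (s • n, u)) (fderiv ℝ ξ (s • n, u) (n, 0)) s := by
    intro u s
    have a : HasDerivAt (fun s : ℝ => (s • n, u)) (n, (0:E3)) s := by
      have := ((hasDerivAt_id s).smul_const n).prodMk (hasDerivAt_const s u)
      simpa using this
    exact (hd (s • n, u)).hasFDerivAt.comp_hasDerivAt s a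
  have hq0 : ∀ s : ℝ, fderiv ℝ ξ (s • n, vp) (n, 0) = 0 := by
    intro s
    have a := hline vp s
    have b : (fun s : ℝ => ξ (s • n, vp)) = fun _ => 0 := by
      ext s; apply h0; rw [inner_smul_left, hnvp]; simp
    rw [b] at a
    exact a.unique (hasDerivAt_const s 0)
  have hq : ∀ s : ℝ, ‖fderiv ℝ ξ (s • n, v) (n, 0)‖ ≤ M * |t| := by
    intro s
    have a := hM.dist_le_mul (s • n, v) (s • n, vp)
    have b : dist ((s • n, v) : Phase) (s • n, vp) = |t| := by
      rw [Prod.dist_eq, dist_self, dist_eq_norm, hvp]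
      simp [norm_smul, hnn]
    rw [b, dist_eq_norm] at a
    calc ‖fderiv ℝ ξ (s • n, v) (n, 0)‖ = ‖(fderiv ℝ ξ (s • n, v) - fderiv ℝ ξ (s • n, vp)) (n, 0)‖ := by
          rw [sub_apply, hq0, sub_zero]
      _ ≤ ‖fderiv ℝ ξ (s • n, v) - fderiv ℝ ξ (s • n, vp)‖ * ‖((n, 0) : Phase)‖ := ContinuousLinearMap.le_opNorm _ _
      _ ≤ M * |t| := by
          have : ‖((n, 0) : Phase)‖ = 1 := by rw [Prod.norm_def]; simp [hnn]
          rw [this, mul_one]; exact a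
  have hfin := norm_image_sub_le_of_norm_deriv_le_segment' (f := fun s : ℝ => ξ (s • n, v))
    (f' := fun s => fderiv ℝ ξ (s • n, v) (n, 0)) (a := 0) (b := ‖x‖) (C := M * |t|)
    (fun s _ => (hline v s).hasDerivWithinAt) (fun s _ => hq s) ‖x‖ (right_mem_Icc.2 hxp.le)
  rw [← hxn, zero_smul, h0 0 v (by simp), sub_zero, sub_zero, Real.norm_eq_abs] at hfin
  refine hfin.trans (le_of_eq ?_)
  have : inner ℝ x v = ‖x‖ * t := by
    rw [ht, hn, inner_smul_left]; simp; field_simp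
  simp only [this]
  rw [abs_mul, abs_of_pos hxp]; ring

section
variable {Q : Phase → ℝ} {F : ℝ → ℝ → ℝ} {e₀ : ℝ}

lemma wt_nonneg (z : Phase) : 0 ≤ wt Q F z := by unfold wt; positivity

lemma wt_contAt (hQ : AssumptionA Q F e₀) {z : Phase} (hz : 0 < Q z) : ContinuousAt (wt Q F) z := by
  have hc : ContinuousOn (fun z => 1 / |Fe F (microE Q z, ellOf z)|) {z | 0 < Q z} := by
    have h1 : ContinuousOn (fun z => Fe F (microE Q z, ellOf z)) {z | 0 < Q z} :=
      (Fe_cont hQ).comp (me_cont hQ).continuousOn (fun z hz => mem_S hQ hz)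
    apply continuousOn_const.div h1.abs
    intro z hz
    exact abs_ne_zero.2 (Fe_neg hQ (mem_S hQ hz)).ne
  exact hc.continuousAt ((isOpen_lt continuous_const hQ.contQ).mem_nhds hz)

lemma wt_mul_cont (hQ : AssumptionA Q F e₀) {X : Phase → ℝ} (hX : Continuous X)
    (hs : tsupport X ⊆ {z | 0 < Q z}) : Continuous (fun z => wt Q F z * X z) := by
  apply continuous_of_tsupport
  intro z hz
  have hz' : z ∈ tsupport X := closure_mono (Function.support_mul_subset_right _ _) hz
  exact (wt_contAt hQ (hs hz')).mul hX.continuousAt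

lemma wt_mul_int (hQ : AssumptionA Q F e₀) {X : Phase → ℝ} (hX : Continuous X)
    (hXc : HasCompactSupport X) (hs : tsupport X ⊆ {z | 0 < Q z}) :
    Integrable (fun z => wt Q F z * X z) :=
  (wt_mul_cont hQ hX hs).integrable_of_hasCompactSupport hXc.mul_left

end



section
variable {Q : Phase → ℝ} {F : ℝ → ℝ → ℝ} {e₀ : ℝ}

def tdir (Q : Phase → ℝ) (z : Phase) : Phase := (z.2, -(kf (Prad Q) ‖z.1‖ • z.1))
def muF (z : Phase) : ℝ := inner ℝ z.1 z.2
def AF (Q : Phase → ℝ) (z : Phase) : ℝ := ‖z.2‖ ^ 2 - ‖z.1‖ ^ 2 * kf (Prad Q) ‖z.1‖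
def BF (Q : Phase → ℝ) (z : Phase) : ℝ := kf (Prad Q) ‖z.1‖ + Prad Q ‖z.1‖

lemma tdir_cont (hQ : AssumptionA Q F e₀) : Continuous (tdir Q) := by
  have := kf_cont (Prad_cont hQ.contQ hQ.cpt)
  unfold tdir; fun_prop

lemma BF_cont (hQ : AssumptionA Q F e₀) : Continuous (BF Q) := by
  have := kf_cont (Prad_cont hQ.contQ hQ.cpt)
  have := Prad_cont hQ.contQ hQ.cpt
  unfold BF; fun_prop

lemma muF_contDiff : ContDiff ℝ 1 muF := by
  have h1 : ContDiff ℝ 1 (fun z : Phase => z.1) := contDiff_fst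
  have h2 : ContDiff ℝ 1 (fun z : Phase => z.2) := contDiff_snd
  exact h1.inner ℝ h2

lemma muF_T (z : Phase) : fderiv ℝ muF z (tdir Q z) = AF Q z := by
  have h1 : HasFDerivAt (fun z : Phase => z.1) (ContinuousLinearMap.fst ℝ E3 E3) z := hasFDerivAt_fst
  have h2 : HasFDerivAt (fun z : Phase => z.2) (ContinuousLinearMap.snd ℝ E3 E3) z := hasFDerivAt_snd
  have h : HasFDerivAt muF _ z := h1.inner ℝ h2
  rw [h.fderiv]
  simp [tdir, AF, inner_smul_right]
  ring

lemma AF_contDiff (hQ : AssumptionA Q F e₀) : ContDiff ℝ 1 (AF Q) := by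
  have hP := Prad_cont hQ.contQ hQ.cpt
  have hk := kf_cont hP
  have h2 : ContDiff ℝ 1 (fun z : Phase => z.2) := contDiff_snd
  have h3 : ContDiff ℝ 1 (fun x : E3 => ‖x‖ ^ 2 * kf (Prad Q) ‖x‖) := by
    rw [contDiff_one_iff_hasFDerivAt]
    refine ⟨_, ?_, rad_fderiv (d := fun r => Prad Q r - kf (Prad Q) r) hk (fun r hr => kf_deriv hP hr)⟩
    fun_prop
  exact (h2.norm_sq ℝ).sub (h3.comp contDiff_fst)

lemma AF_T (hQ : AssumptionA Q F e₀) (z : Phase) :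
    fderiv ℝ (AF Q) z (tdir Q z) = - (BF Q z * muF z) := by
  have hP := Prad_cont hQ.contQ hQ.cpt
  have hk := kf_cont hP
  have h1 : HasFDerivAt (fun z : Phase => z.1) (ContinuousLinearMap.fst ℝ E3 E3) z := hasFDerivAt_fst
  have h2 : HasFDerivAt (fun z : Phase => z.2) (ContinuousLinearMap.snd ℝ E3 E3) z := hasFDerivAt_snd
  have h3 := rad_fderiv (d := fun r => Prad Q r - kf (Prad Q) r) hk (fun r hr => kf_deriv hP hr) z.1
  have h : HasFDerivAt (AF Q) _ z := h2.norm_sq.sub (h3.comp z h1)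
  rw [h.fderiv]
  simp [tdir, BF, muF, inner_smul_right, real_inner_comm z.1 z.2]
  ring

lemma step1_eps (hQ : AssumptionA Q F e₀) {ξ : Phase → ℝ} (hsm : ContDiff ℝ 1 ξ)
    (hc : HasCompactSupport ξ) (hsupp : tsupport ξ ⊆ {z | 0 < Q z}) {ε : ℝ} (hε : 0 < ε) :
    ∫ z, wt Q F z * (ξ z ^ 2 * (BF Q z * muF z ^ 2 / (muF z ^ 2 + ε ^ 2)
        - AF Q z ^ 2 * ε ^ 2 / (muF z ^ 2 + ε ^ 2) ^ 2))
      ≤ ∫ z, wt Q F z * (fderiv ℝ ξ z (tdir Q z)) ^ 2 := by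
  set D : Phase → ℝ := fun z => muF z ^ 2 + ε ^ 2 with hD
  have hDp : ∀ z, 0 < D z := fun z => by simp only [hD]; positivity
  set h : Phase → ℝ := fun z => muF z * AF Q z / D z * ξ z ^ 2 with hh
  have hmu := muF_contDiff
  have hA := AF_contDiff hQ
  have hDc : ContDiff ℝ 1 D := (hmu.pow 2).add contDiff_const
  have hhd : ContDiff ℝ 1 h := ((hmu.mul hA).div hDc (fun z => (hDp z).ne')).mul (hsm.pow 2)
  have hsub : ∀ X : Phase → ℝ, (∀ z, ξ z = 0 → X z = 0) → tsupport X ⊆ tsupport ξ := by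
    intro X hX
    apply closure_mono
    intro z hz hz0
    exact hz (hX z hz0)
  have hhs : tsupport h ⊆ tsupport ξ := hsub h (fun z hz => by simp [hh, hz])
  have hhc : HasCompactSupport h := hc.of_isClosed_subset (isClosed_tsupport _) hhs
  have h0 := int_w_T hQ hhd hhc (hhs.trans hsupp)
  set X : Phase → ℝ := fun z => ξ z ^ 2 * (BF Q z * muF z ^ 2 / D z
        - AF Q z ^ 2 * ε ^ 2 / D z ^ 2) with hX
  have hXc : Continuous X := by
    have := BF_cont hQ
    have h1 := hmu.continuous
    have h2 := hA.continuous
    have h3 := hDc.continuous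
    have h4 := hsm.continuous
    exact (h4.pow 2).mul (((this.mul (h1.pow 2)).div h3 (fun z => (hDp z).ne')).sub
      (((h2.pow 2).mul continuous_const).div (h3.pow 2) (fun z => (pow_pos (hDp z) 2).ne')))
  have hXs : tsupport X ⊆ tsupport ξ := hsub X (fun z hz => by simp [hX, hz])
  have hXi := wt_mul_int hQ hXc (hc.of_isClosed_subset (isClosed_tsupport _) hXs) (hXs.trans hsupp)
  have hTs : ∀ g : Phase → ℝ, tsupport g ⊆ tsupport ξ →
      tsupport (fun z => fderiv ℝ g z (tdir Q z)) ⊆ tsupport ξ := by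
    intro g hg
    refine closure_minimal ?_ (isClosed_tsupport _)
    intro z hz
    refine hg (support_fderiv_subset ℝ (f := g) ?_)
    intro h0; exact hz (by simp [h0])
  have hTc : ∀ g : Phase → ℝ, ContDiff ℝ 1 g → Continuous (fun z => fderiv ℝ g z (tdir Q z)) :=
    fun g hg => fderiv_app_cont hg (tdir_cont hQ)
  have hThi := wt_mul_int hQ (hTc h hhd)
    (hc.of_isClosed_subset (isClosed_tsupport _) (hTs h hhs)) ((hTs h hhs).trans hsupp)
  have hsq : tsupport (fun z => (fderiv ℝ ξ z (tdir Q z)) ^ 2) ⊆ tsupport ξ := by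
    refine (closure_mono ?_).trans (hTs ξ subset_rfl)
    intro z hz h0
    exact hz (by simp only at h0; simp [h0])
  have hTxi := wt_mul_int hQ ((hTc ξ hsm).pow 2)
    (hc.of_isClosed_subset (isClosed_tsupport _) hsq) (hsq.trans hsupp)
  have key : ∀ z, fderiv ℝ h z (tdir Q z) + X z ≤ (fderiv ℝ ξ z (tdir Q z)) ^ 2 := by
    intro z
    have l : ∀ g : Phase → ℝ, ContDiff ℝ 1 g →
        HasDerivAt (fun t : ℝ => g (z + t • tdir Q z)) (fderiv ℝ g z (tdir Q z)) 0 :=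
      fun g hg => (hg.differentiable one_ne_zero z).hasFDerivAt.hasLineDerivAt _
    have lm := l _ hmu
    have la := l _ hA
    have lx := l _ hsm
    rw [muF_T] at lm
    rw [AF_T hQ] at la
    have e0 : z + (0:ℝ) • tdir Q z = z := by simp
    have hne : muF (z + (0:ℝ) • tdir Q z) ^ 2 + ε ^ 2 ≠ 0 := (hDp _).ne'
    have lall := ((lm.mul la).div ((lm.pow 2).add_const (ε ^ 2)) hne).mul (lx.pow 2)
    have lh := (l _ hhd).unique lall
    rw [lh]
    simp only [e0, Pi.pow_apply, Pi.mul_apply, Pi.div_apply]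
    have hp : 0 < muF z ^ 2 + ε ^ 2 := hDp z
    simp only [hX, hD]
    set m := muF z
    set A := AF Q z
    set B := BF Q z
    set t := fderiv ℝ ξ z (tdir Q z)
    set q := ξ z
    rw [← sub_nonneg]
    have : 0 ≤ (t - m * A / (m ^ 2 + ε ^ 2) * q) ^ 2 := sq_nonneg _
    refine this.trans (le_of_eq ?_)
    field_simp
    push_cast
    ring
  have hle : ∫ z, (wt Q F z * fderiv ℝ h z (tdir Q z) + wt Q F z * X z)
      ≤ ∫ z, wt Q F z * (fderiv ℝ ξ z (tdir Q z)) ^ 2 := by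
    refine integral_mono (hThi.add hXi) hTxi fun z => ?_
    have := mul_le_mul_of_nonneg_left (key z) (wt_nonneg (Q := Q) (F := F) z)
    simp only [mul_add] at this
    exact this
  rw [integral_add hThi hXi] at hle
  have h0' : ∫ z, wt Q F z * fderiv ℝ h z (tdir Q z) = 0 := h0
  rw [h0', zero_add] at hle
  exact hle

lemma step1 (hQ : AssumptionA Q F e₀) {ξ : Phase → ℝ} (hsm : ContDiff ℝ (⊤ : ℕ∞) ξ)
    (hc : HasCompactSupport ξ) (hsupp : tsupport ξ ⊆ {z | 0 < Q z})
    (h0 : ∀ x v : E3, inner ℝ x v = 0 → ξ (x, v) = 0) :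
    ∫ z, wt Q F z * (ξ z ^ 2 * BF Q z) ≤ ∫ z, wt Q F z * (fderiv ℝ ξ z (tdir Q z)) ^ 2 := by
  have hsm1 : ContDiff ℝ 1 ξ := contDiff_infty.1 hsm 1
  obtain ⟨C, hC0, hC⟩ := mixed_bound hsm hc h0
  have hBc := BF_cont hQ
  have hAc := (AF_contDiff hQ).continuous
  have hmc := muF_contDiff.continuous
  have hξc := hsm1.continuous
  set K := tsupport ξ with hK
  have hKc : IsCompact K := hc
  have hwK : ContinuousOn (wt Q F) K := fun z hz => (wt_contAt hQ (hsupp hz)).continuousWithinAt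
  set bd : Phase → ℝ := K.indicator (fun z => wt Q F z * (ξ z ^ 2 * |BF Q z| + C ^ 2 * AF Q z ^ 2)) with hbd
  have hbdi : Integrable bd := by
    rw [hbd, integrable_indicator_iff hKc.measurableSet]
    apply ContinuousOn.integrableOn_compact hKc
    exact hwK.mul (by fun_prop)
  refine le_of_tendsto' (f := fun n : ℕ => ∫ z, wt Q F z * (ξ z ^ 2 * (BF Q z * muF z ^ 2 / (muF z ^ 2 + (1 / ((n:ℝ) + 1)) ^ 2)
        - AF Q z ^ 2 * (1 / ((n:ℝ) + 1)) ^ 2 / (muF z ^ 2 + (1 / ((n:ℝ) + 1)) ^ 2) ^ 2)))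
      (x := atTop) ?_ (fun n => step1_eps hQ hsm1 hc hsupp (by positivity))
  apply tendsto_integral_of_dominated_convergence bd
  · intro n
    have hX : Continuous (fun z => ξ z ^ 2 * (BF Q z * muF z ^ 2 / (muF z ^ 2 + (1 / ((n:ℝ) + 1)) ^ 2)
        - AF Q z ^ 2 * (1 / ((n:ℝ) + 1)) ^ 2 / (muF z ^ 2 + (1 / ((n:ℝ) + 1)) ^ 2) ^ 2)) := by
      have hp : ∀ z, 0 < muF z ^ 2 + (1 / ((n:ℝ) + 1)) ^ 2 := fun z => by positivity
      refine (hξc.pow 2).mul (Continuous.sub (Continuous.div (by fun_prop) (by fun_prop) (fun z => (hp z).ne'))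
        (Continuous.div (by fun_prop) (by fun_prop) (fun z => (pow_pos (hp z) 2).ne')))
    refine (wt_mul_cont hQ hX ?_).aestronglyMeasurable
    refine (closure_mono ?_).trans hsupp
    intro z hz hz0
    exact hz (by simp [hz0])
  · exact hbdi
  · intro n
    refine Eventually.of_forall fun z => ?_
    set ε : ℝ := 1 / ((n:ℝ) + 1)
    have hε : 0 < ε := by positivity
    by_cases hz : z ∈ K
    · rw [hbd, indicator_of_mem hz, norm_mul, Real.norm_eq_abs, abs_of_nonneg (wt_nonneg z)]
      refine mul_le_mul_of_nonneg_left ?_ (wt_nonneg z)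
      rw [Real.norm_eq_abs, mul_sub]
      have hD : 0 < muF z ^ 2 + ε ^ 2 := by positivity
      have hx2 : ξ z ^ 2 ≤ C ^ 2 * muF z ^ 2 := by
        have := pow_le_pow_left₀ (abs_nonneg _) (hC z) 2
        rwa [mul_pow, sq_abs, sq_abs] at this
      refine (abs_sub _ _).trans (add_le_add ?_ ?_)
      · rw [abs_mul, abs_of_nonneg (sq_nonneg (ξ z))]
        refine mul_le_mul_of_nonneg_left ?_ (sq_nonneg _)
        rw [abs_div, abs_mul, abs_of_pos hD, abs_of_nonneg (sq_nonneg (muF z)), div_le_iff₀ hD]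
        refine mul_le_mul_of_nonneg_left ?_ (abs_nonneg _)
        nlinarith [sq_nonneg ε]
      · rw [abs_of_nonneg (by positivity), ← mul_div_assoc, div_le_iff₀ (by positivity)]
        have e1 : ξ z ^ 2 * (AF Q z ^ 2 * ε ^ 2) ≤ C ^ 2 * muF z ^ 2 * (AF Q z ^ 2 * ε ^ 2) :=
          mul_le_mul_of_nonneg_right hx2 (by positivity)
        refine e1.trans ?_
        have : C ^ 2 * AF Q z ^ 2 * (muF z ^ 2 + ε ^ 2) ^ 2 - C ^ 2 * muF z ^ 2 * (AF Q z ^ 2 * ε ^ 2)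
          = C ^ 2 * AF Q z ^ 2 * (muF z ^ 4 + muF z ^ 2 * ε ^ 2 + ε ^ 4) := by ring
        have h2 : 0 ≤ C ^ 2 * AF Q z ^ 2 * (muF z ^ 4 + muF z ^ 2 * ε ^ 2 + ε ^ 4) := by positivity
        linarith
    · have : ξ z = 0 := image_eq_zero_of_notMem_tsupport hz
      rw [hbd, indicator_of_notMem hz, this]; simp
  · refine Eventually.of_forall fun z => ?_
    by_cases hm : muF z = 0
    · have : ξ z = 0 := h0 z.1 z.2 hm
      simp [this]
    · have he : Tendsto (fun n : ℕ => 1 / ((n:ℝ) + 1)) atTop (𝓝 0) := tendsto_one_div_add_atTop_nhds_zero_nat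
      have hm2 : muF z ^ 2 ≠ 0 := pow_ne_zero 2 hm
      have hp : ∀ ε : ℝ, 0 < muF z ^ 2 + ε ^ 2 := fun ε => by positivity
      have hcont : Continuous (fun ε : ℝ => wt Q F z * (ξ z ^ 2 * (BF Q z * muF z ^ 2 / (muF z ^ 2 + ε ^ 2)
        - AF Q z ^ 2 * ε ^ 2 / (muF z ^ 2 + ε ^ 2) ^ 2))) := by
        exact continuous_const.mul (continuous_const.mul
          ((Continuous.div (by fun_prop) (by fun_prop) (fun ε => (hp ε).ne')).sub
            (Continuous.div (by fun_prop) (by fun_prop) (fun ε => (pow_pos (hp ε) 2).ne'))))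
      have := (hcont.tendsto 0).comp he
      have e : wt Q F z * (ξ z ^ 2 * BF Q z) = wt Q F z * (ξ z ^ 2 * (BF Q z * muF z ^ 2 / (muF z ^ 2 + (0:ℝ) ^ 2)
        - AF Q z ^ 2 * (0:ℝ) ^ 2 / (muF z ^ 2 + (0:ℝ) ^ 2) ^ 2)) := by
        have : BF Q z * muF z ^ 2 / muF z ^ 2 = BF Q z := by field_simp
        simp [this]
      rw [e]
      exact this
end



section
variable {Q : Phase → ℝ} {F : ℝ → ℝ → ℝ} {e₀ : ℝ}

lemma rhoF_line {η : Phase → ℝ} (hd : ContDiff ℝ 1 η) (hs : HasCompactSupport η) (x e : E3) :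
    HasDerivAt (fun t : ℝ => rhoF η (x + t • e)) (∫ v, fderiv ℝ η (x, v) (e, 0)) 0 := by
  have hc := fderiv_app_cont hd (c := fun _ => ((e, 0) : Phase)) continuous_const
  have hsc := fderiv_app_supp hs (fun _ => ((e, 0) : Phase))
  obtain ⟨C, hC⟩ := hsc.exists_bound_of_continuous hc
  have hK : IsCompact (Prod.snd '' tsupport η) := hs.image continuous_snd
  have key := hasDerivAt_integral_of_dominated_loc_of_deriv_le (μ := (volume : Measure E3))
    (F := fun (t : ℝ) v => η (x + t • e, v)) (F' := fun (t : ℝ) v => fderiv ℝ η (x + t • e, v) (e, 0))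
    (x₀ := 0) (s := univ) (bound := (Prod.snd '' tsupport η).indicator (fun _ => C)) univ_mem ?_ ?_ ?_ ?_ ?_ ?_
  · have := key.2
    simpa [rhoF] using this
  · have := hd.continuous
    exact Eventually.of_forall fun t => (by fun_prop : Continuous fun v => η (x + t • e, v)).aestronglyMeasurable
  · have := hd.continuous
    exact (by fun_prop : Continuous fun v => η (x + (0:ℝ) • e, v)).integrable_of_hasCompactSupport (slice_supp2 hs _)
  · exact (hc.comp (by fun_prop : Continuous fun v : E3 => (x + (0:ℝ) • e, v))).aestronglyMeasurable
  · refine Eventually.of_forall fun v t _ => ?_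
    by_cases hv : v ∈ Prod.snd '' tsupport η
    · rw [indicator_of_mem hv]; exact hC _
    · rw [indicator_of_notMem hv]
      have : fderiv ℝ η (x + t • e, v) = 0 := by
        by_contra h
        exact hv ⟨_, support_fderiv_subset ℝ (f := η) h, rfl⟩
      simp [this]
  · rw [integrable_indicator_iff hK.measurableSet]
    exact integrableOn_const hK.measure_lt_top.ne
  · refine Eventually.of_forall fun v t _ => ?_
    have a : HasDerivAt (fun t : ℝ => ((x + t • e, v) : Phase)) (e, 0) t := by
      have := (((hasDerivAt_id t).smul_const e).const_add x).prodMk (hasDerivAt_const t v)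
      simpa using this
    exact (hd.differentiable one_ne_zero _).hasFDerivAt.comp_hasDerivAt t a

lemma fderiv_rot {ξ : Phase → ℝ} (hd : Differentiable ℝ ξ) (hs : SphSym ξ) (R : E3 ≃ₗᵢ[ℝ] E3)
    (hR : LinearMap.det (R.toLinearEquiv : E3 →ₗ[ℝ] E3) = 1) (z w : Phase) :
    fderiv ℝ ξ (R z.1, R z.2) (R w.1, R w.2) = fderiv ℝ ξ z w := by
  have h1 := (hd (R z.1, R z.2)).hasFDerivAt.hasLineDerivAt (R w.1, R w.2)
  have h2 := (hd z).hasFDerivAt.hasLineDerivAt w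
  unfold HasLineDerivAt at h1 h2
  refine h1.unique (h2.congr_of_eventuallyEq (Eventually.of_forall fun t => ?_))
  have := hs R hR (z + t • w)
  simpa using this

lemma T_sph {ξ : Phase → ℝ} (hd : Differentiable ℝ ξ) (hs : SphSym ξ) :
    SphSym (fun z => fderiv ℝ ξ z (tdir Q z)) := by
  intro R hR z
  have := fderiv_rot hd hs R hR z (tdir Q z)
  simp only [tdir] at this ⊢
  rw [← this]; simp

def eb (i : Fin 3) : E3 := EuclideanSpace.single i (1:ℝ)

def jf (ξ : Phase → ℝ) (i : Fin 3) (x : E3) : ℝ := rhoF (fun z => z.2 i * ξ z) x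

lemma cdc (i : Fin 3) : ContDiff ℝ 1 (fun z : Phase => z.2 i) := by fun_prop

lemma jf_line {ξ : Phase → ℝ} (hd : ContDiff ℝ 1 ξ) (hs : HasCompactSupport ξ) (i : Fin 3) (x e : E3) :
    HasDerivAt (fun t : ℝ => jf ξ i (x + t • e)) (∫ v : E3, v i * fderiv ℝ ξ (x, v) (e, 0)) 0 := by
  refine (rhoF_line (((cdc i).mul hd)) (hs.mul_left) x e).congr_deriv ?_
  congr 1; ext v
  have h1 := (hd.differentiable one_ne_zero (x, v)).hasFDerivAt.hasLineDerivAt (e, 0)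
  have h2 := (((cdc i).mul hd).differentiable one_ne_zero (x, v)).hasFDerivAt.hasLineDerivAt (e, 0)
  unfold HasLineDerivAt at h1 h2
  have h3 := h1.const_mul (v i)
  refine h2.unique (h3.congr_of_eventuallyEq (Eventually.of_forall fun t => ?_))
  simp

lemma jf_cont {ξ : Phase → ℝ} (hc : Continuous ξ) (hs : HasCompactSupport ξ) (i : Fin 3) :
    Continuous (jf ξ i) :=
  rhoF_cont (f := fun z => z.2 i * ξ z) (by fun_prop) hs.mul_left

lemma j_perp {ξ : Phase → ℝ} (hs : SphSym ξ) {x u : E3} (hx : x ≠ 0) (hu : inner ℝ x u = 0) :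
    ∫ v, inner ℝ u v * ξ (x, v) = 0 := by
  obtain ⟨R, h1, h2, h3⟩ := halfTurn x hx
  have h := R.measurePreserving.integral_comp R.toHomeomorph.measurableEmbedding (fun v => inner ℝ u v * ξ (x, v))
  have e : ∀ v, inner ℝ u (R v) * ξ (x, R v) = -(inner ℝ u v * ξ (x, v)) := by
    intro v
    have a := hs R h1 (x, v)
    simp only [h2] at a
    have b : inner ℝ u (R v) = - inner ℝ u v := by
      have := R.inner_map_map u v
      rw [h3 u hu] at this
      rw [inner_neg_left] at this
      linarith
    rw [a, b]; ring
  have e2 : ∫ v, inner ℝ u (R v) * ξ (x, R v) = ∫ v, -(inner ℝ u v * ξ (x, v)) := by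
    congr 1; ext v; exact e v
  have h' : ∫ v, inner ℝ u (R v) * ξ (x, R v) = ∫ v, inner ℝ u v * ξ (x, v) := h
  rw [e2, integral_neg] at h'
  linarith

lemma j_side {ξ : Phase → ℝ} (hd : ContDiff ℝ 1 ξ) (hc : HasCompactSupport ξ) (hs : SphSym ξ) {i : Fin 3}
    (hi : i ≠ 0) {r : ℝ} (hr : 0 < r) :
    r * ∫ v : E3, v i * fderiv ℝ ξ (r • e0v, v) (eb i, 0) = jf ξ 0 (r • e0v) := by
  have hrel : ∀ t : ℝ, r * jf ξ i (r • e0v + t • eb i) = t * jf ξ 0 (r • e0v + t • eb i) := by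
    intro t
    set x := r • e0v + t • eb i with hx
    have hx0 : x 0 = r := by simp [hx, eb, hi]
    have hxne : x ≠ 0 := by
      intro h; rw [h] at hx0; simp at hx0; exact hr.ne hx0
    have := j_perp hs (x := x) (u := r • eb i - t • e0v) hxne (by
      simp [hx, eb, inner_add_left, inner_sub_right, inner_smul_left, inner_smul_right,
        EuclideanSpace.inner_single_left, hi, hi.symm]; ring)
    have e : ∀ v : E3, inner ℝ (r • eb i - t • e0v) v * ξ (x, v) = r * (v i * ξ (x, v)) - t * (v 0 * ξ (x, v)) := by
      intro v
      simp [eb, inner_sub_left, inner_smul_left, EuclideanSpace.inner_single_left]; ring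
    simp_rw [e] at this
    have hint : ∀ k : Fin 3, Integrable (fun v : E3 => v k * ξ (x, v)) := by
      intro k
      have := hd.continuous
      exact (by fun_prop : Continuous fun v : E3 => v k * ξ (x, v)).integrable_of_hasCompactSupport
        (slice_supp2 hc x).mul_left
    rw [integral_sub ((hint i).const_mul r) ((hint 0).const_mul t), integral_const_mul, integral_const_mul] at this
    simp only [jf, rhoF]
    linarith
  have h1 := (jf_line hd hc i (r • e0v) (eb i)).const_mul r
  have h2 := (hasDerivAt_id (0:ℝ)).mul (jf_line hd hc 0 (r • e0v) (eb i))
  have h3 := h1.unique (h2.congr_of_eventuallyEq (Eventually.of_forall fun t => hrel t))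
  rw [h3]; simp

lemma rho_T {ξ : Phase → ℝ} (hQ : AssumptionA Q F e₀) (hd : ContDiff ℝ 1 ξ) (hc : HasCompactSupport ξ)
    (hs : SphSym ξ) {r : ℝ} (hr : 0 < r) :
    Prad (fun z => fderiv ℝ ξ z (tdir Q z)) r =
      (∫ v : E3, v 0 * fderiv ℝ ξ (r • e0v, v) (e0v, 0)) + 2 * (jf ξ 0 (r • e0v) / r) := by
  set x := r • e0v with hx
  have hint : ∀ k : Fin 3, Integrable (fun v : E3 => v k * fderiv ℝ ξ (x, v) (eb k, 0)) := by
    intro k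
    have h1 := (fderiv_app_cont hd (c := fun _ => (eb k, 0)) continuous_const).comp (by fun_prop : Continuous fun v : E3 => (x, v))
    have h2 := slice_supp2 (fderiv_app_supp hc (fun _ => (eb k, 0))) x
    exact ((by fun_prop : Continuous fun v : E3 => v k).mul h1).integrable_of_hasCompactSupport h2.mul_left
  have hint2 : Integrable (fun v : E3 => fderiv ℝ ξ (x, v) (0, -(kf (Prad Q) ‖x‖ • x))) := by
    have h1 := (fderiv_app_cont hd (c := fun _ => (0, -(kf (Prad Q) ‖x‖ • x))) continuous_const).comp (by fun_prop : Continuous fun v : E3 => (x, v))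
    have h2 := slice_supp2 (fderiv_app_supp hc (fun _ => (0, -(kf (Prad Q) ‖x‖ • x)))) x
    exact h1.integrable_of_hasCompactSupport h2
  have e : ∀ v : E3, fderiv ℝ ξ (x, v) (tdir Q (x, v)) =
      ((v 0 * fderiv ℝ ξ (x, v) (eb 0, 0) + v 1 * fderiv ℝ ξ (x, v) (eb 1, 0)) + v 2 * fderiv ℝ ξ (x, v) (eb 2, 0))
        + fderiv ℝ ξ (x, v) (0, -(kf (Prad Q) ‖x‖ • x)) := by
    intro v
    have : tdir Q (x, v) = ((v 0 • ((eb 0, 0) : Phase) + v 1 • ((eb 1, 0) : Phase)) + v 2 • ((eb 2, 0) : Phase))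
        + ((0, -(kf (Prad Q) ‖x‖ • x)) : Phase) := by
      simp only [tdir, Prod.smul_mk, smul_zero, Prod.mk_add_mk, add_zero, zero_add]
      congr 1
      ext i
      fin_cases i <;> simp [eb]
    rw [this]
    simp only [map_add, map_smul, smul_eq_mul]
  unfold Prad rhoF
  rw [← hx]
  simp_rw [e]
  have i01 : Integrable (fun v : E3 => v 0 * fderiv ℝ ξ (x, v) (eb 0, 0) + v 1 * fderiv ℝ ξ (x, v) (eb 1, 0)) :=
    (hint 0).add (hint 1)
  have i012 : Integrable (fun v : E3 => v 0 * fderiv ℝ ξ (x, v) (eb 0, 0) + v 1 * fderiv ℝ ξ (x, v) (eb 1, 0)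
      + v 2 * fderiv ℝ ξ (x, v) (eb 2, 0)) := i01.add (hint 2)
  rw [integral_add i012 hint2, integral_add i01 (hint 2),
    integral_add (hint 0) (hint 1), int_v_part hd hc]
  have s1 := j_side hd hc hs (i := 1) (by simp) hr
  have s2 := j_side hd hc hs (i := 2) (by simp) hr
  rw [← hx] at s1 s2
  have s1' : ∫ v : E3, v 1 * fderiv ℝ ξ (x, v) (eb 1, 0) = jf ξ 0 x / r := by rw [← s1]; field_simp
  have s2' : ∫ v : E3, v 2 * fderiv ℝ ξ (x, v) (eb 2, 0) = jf ξ 0 x / r := by rw [← s2]; field_simp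
  rw [s1', s2']
  simp only [eb]
  ring

lemma kf_T {ξ : Phase → ℝ} (hQ : AssumptionA Q F e₀) (hd : ContDiff ℝ 1 ξ) (hc : HasCompactSupport ξ)
    (hs : SphSym ξ) {r : ℝ} (hr : 0 < r) :
    kf (Prad (fun z => fderiv ℝ ξ z (tdir Q z))) r = jf ξ 0 (r • e0v) / r := by
  set P := Prad (fun z => fderiv ℝ ξ z (tdir Q z)) with hP
  have hPc : Continuous P := Prad_cont (fderiv_app_cont hd (tdir_cont hQ)) (fderiv_app_supp hc _)
  have hJ : ∀ t : ℝ, HasDerivAt (fun t : ℝ => jf ξ 0 (t • e0v))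
      (∫ v : E3, v 0 * fderiv ℝ ξ (t • e0v, v) (e0v, 0)) t := by
    intro t
    have h1 := jf_line hd hc 0 (t • e0v) e0v
    have h2 : HasDerivAt (fun s : ℝ => s - t) 1 t := (hasDerivAt_id t).sub_const t
    have h1' : HasDerivAt (fun s : ℝ => jf ξ 0 (t • e0v + s • e0v))
      (∫ v : E3, v 0 * fderiv ℝ ξ (t • e0v, v) (e0v, 0)) (t - t) := by rw [sub_self]; exact h1
    have h3 := HasDerivAt.comp (h := fun s : ℝ => s - t) t h1' h2
    rw [mul_one] at h3
    refine h3.congr_of_eventuallyEq (Eventually.of_forall fun s => ?_)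
    simp only [Function.comp]
    rw [← add_smul]; simp
  have hF := intervalIntegral.integral_eq_sub_of_hasDerivAt (a := 0) (b := r)
    (f := fun t : ℝ => t ^ 2 * jf ξ 0 (t • e0v)) (f' := fun t => t ^ 2 * P t) ?_
    ((by fun_prop : Continuous fun t => t ^ 2 * P t).intervalIntegrable _ _)
  · rw [kf_eq P hr, hF]
    field_simp
    ring
  · intro t ht
    rw [uIcc_of_le hr.le] at ht
    have h := (hasDerivAt_pow 2 t).mul (hJ t)
    refine h.congr_deriv ?_
    rcases ht.1.eq_or_lt with h0 | h0
    · subst h0; simp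
    · rw [hP, rho_T hQ hd hc hs h0]
      field_simp
      push_cast
      ring

lemma gradPhi_T {ξ : Phase → ℝ} (hQ : AssumptionA Q F e₀) (hd : ContDiff ℝ 1 ξ) (hc : HasCompactSupport ξ)
    (hs : SphSym ξ) (x : E3) :
    ‖gradPhi (fun z => fderiv ℝ ξ z (tdir Q z)) x‖ ^ 2 ≤ jf ξ 0 (‖x‖ • e0v) ^ 2 := by
  rw [gradPhi_eq (fderiv_app_cont hd (tdir_cont hQ)) (fderiv_app_supp hc _)
    (T_sph (hd.differentiable one_ne_zero) hs)]
  by_cases hx : x = 0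
  · subst hx; simp; positivity
  · have hxp : 0 < ‖x‖ := norm_pos_iff.2 hx
    rw [kf_T hQ hd hc hs hxp, norm_smul, mul_pow, Real.norm_eq_abs, sq_abs, div_pow]
    rw [div_mul_cancel₀ _ (by positivity)]

end



section
variable {Q : Phase → ℝ} {F : ℝ → ℝ → ℝ} {e₀ : ℝ}

def chi (δ s : ℝ) : ℝ := max 0 (min 1 (2 * s / δ - 1))
def Hc (δ q : ℝ) : ℝ := ∫ s in (0:ℝ)..q, chi δ s

lemma chi_cont (δ : ℝ) : Continuous (chi δ) := by unfold chi; fun_prop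
lemma chi_nonneg (δ s : ℝ) : 0 ≤ chi δ s := le_max_left _ _
lemma chi_le (δ s : ℝ) : chi δ s ≤ 1 := max_le zero_le_one (min_le_left _ _)
lemma chi_one {δ s : ℝ} (hδ : 0 < δ) (h : δ ≤ s) : chi δ s = 1 := by
  have : 1 ≤ 2 * s / δ - 1 := by
    rw [le_sub_iff_add_le, le_div_iff₀ hδ]; linarith
  unfold chi
  rw [min_eq_left this]; simp
lemma chi_zero {δ s : ℝ} (hδ : 0 < δ) (h : s ≤ δ / 2) : chi δ s = 0 := by
  have : 2 * s / δ - 1 ≤ 0 := by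
    rw [sub_nonpos, div_le_iff₀ hδ]; linarith
  unfold chi
  exact max_eq_left ((min_le_right _ _).trans this)

lemma Hc_deriv (δ q : ℝ) : HasDerivAt (Hc δ) (chi δ q) q := ftc_aux (chi_cont δ) q

lemma Hc_zero {δ q : ℝ} (hδ : 0 < δ) (h : q ≤ δ / 2) : Hc δ q = 0 := by
  unfold Hc
  apply intervalIntegral.integral_zero_ae
  refine Eventually.of_forall fun s hs => chi_zero hδ ?_
  rcases le_total 0 q with h0 | h0
  · rw [uIoc_of_le h0] at hs; exact hs.2.trans h
  · rw [uIoc_of_ge h0] at hs; exact hs.2.trans (by positivity)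

lemma Hc_le {δ q : ℝ} (h : 0 ≤ q) : Hc δ q ≤ q := by
  unfold Hc
  have := intervalIntegral.integral_mono_on (μ := volume) h ((chi_cont δ).intervalIntegrable 0 q)
    (continuous_const.intervalIntegrable (u := fun _ => (1:ℝ)) 0 q) (fun s _ => chi_le δ s)
  simpa using this

def Gc (Q : Phase → ℝ) (F : ℝ → ℝ → ℝ) (δ : ℝ) (z : Phase) : ℝ := chi δ (Q z) * Fe F (microE Q z, ellOf z)

lemma Gc_cont (hQ : AssumptionA Q F e₀) {δ : ℝ} (hδ : 0 < δ) : Continuous (Gc Q F δ) := by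
  have h1 : ContinuousOn (fun z => Fe F (microE Q z, ellOf z)) {z | 0 < Q z} :=
    (Fe_cont hQ).comp (me_cont hQ).continuousOn (fun z hz => mem_S hQ hz)
  apply continuous_of_tsupport
  intro z hz
  have hcl : IsClosed {z | δ / 2 ≤ Q z} := isClosed_le continuous_const hQ.contQ
  have hz2 : z ∈ {z | δ / 2 ≤ Q z} := by
    refine closure_minimal ?_ hcl hz
    intro y hy
    by_contra h
    have h : Q y < δ / 2 := not_le.1 h
    exact hy (by simp [Gc, chi_zero hδ h.le])
  have hz3 : δ / 2 ≤ Q z := hz2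
  have hz4 : 0 < Q z := by linarith
  exact ((chi_cont δ).comp hQ.contQ).continuousAt.mul
    (h1.continuousAt ((isOpen_lt continuous_const hQ.contQ).mem_nhds hz4))

lemma Gc_supp (hQ : AssumptionA Q F e₀) {δ : ℝ} (hδ : 0 < δ) : HasCompactSupport (Gc Q F δ) := by
  refine hQ.cpt.mono ?_
  intro z hz h0
  exact hz (by simp [Gc, h0, chi_zero hδ (by positivity : (0:ℝ) ≤ δ / 2)])

lemma HQ_line (hQ : AssumptionA Q F e₀) {δ : ℝ} (hδ : 0 < δ) (r : ℝ) (v : E3) :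
    HasDerivAt (fun t : ℝ => Hc δ (Q (r • e0v, v + t • e0v))) (Gc Q F δ (r • e0v, v) * v 0) 0 := by
  by_cases hq : 0 < Q (r • e0v, v)
  · have hm := mem_S hQ hq
    have hne : deriv (fun e => F e (ellOf (r • e0v, v))) (microE Q (r • e0v, v)) ≠ 0 :=
      (hQ.FeNeg _ _ hm.1 hm.2).ne
    have hF := (differentiableAt_of_deriv_ne_zero hne).hasDerivAt
    have hmic : HasDerivAt (fun t : ℝ => microE Q (r • e0v, v + t • e0v)) (v 0) 0 := by
      have a : HasDerivAt (fun t : ℝ => v + t • e0v) e0v 0 := by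
        simpa using ((hasDerivAt_id (0:ℝ)).smul_const e0v).const_add v
      have b := (a.norm_sq.div_const 2).add_const (phiF Q (r • e0v))
      refine b.congr_deriv ?_
      simp [EuclideanSpace.inner_single_right]
    have hell : ∀ t : ℝ, ellOf (r • e0v, v + t • e0v) = ellOf (r • e0v, v) := by
      intro t
      simp only [ellOf, norm_smul, norm_e0v, norm_add_sq_real, inner_smul_left, inner_smul_right, inner_add_right,
        real_inner_comm e0v v, real_inner_self_eq_norm_sq]
      simp
      ring
    have e0 : v + (0:ℝ) • e0v = v := by simp
    have hF' : HasDerivAt (fun e => F e (ellOf (r • e0v, v)))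
        (deriv (fun e => F e (ellOf (r • e0v, v))) (microE Q (r • e0v, v))) (microE Q (r • e0v, v + (0:ℝ) • e0v)) := by
      rw [e0]; exact hF
    have h1 := HasDerivAt.comp (h := fun t : ℝ => microE Q (r • e0v, v + t • e0v)) 0 hF' hmic
    have h2 : HasDerivAt (fun t : ℝ => Q (r • e0v, v + t • e0v)) _ 0 :=
      h1.congr_of_eventuallyEq (Eventually.of_forall fun t => by
        simp only [Function.comp]; rw [hQ.eqF, hell])
    have h3 := HasDerivAt.comp (h := fun t : ℝ => Q (r • e0v, v + t • e0v)) 0 (Hc_deriv δ _) h2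
    refine h3.congr_deriv ?_
    rw [e0]
    simp only [Gc, Fe]
    ring
  · have hq0 : Q (r • e0v, v) = 0 := le_antisymm (not_lt.1 hq) (hQ.nonneg _)
    have hG : Gc Q F δ (r • e0v, v) = 0 := by
      simp [Gc, hq0, chi_zero hδ (by positivity : (0:ℝ) ≤ δ / 2)]
    rw [hG, zero_mul]
    refine (hasDerivAt_const (0:ℝ) (0:ℝ)).congr_of_eventuallyEq ?_
    have hc : ContinuousAt (fun t : ℝ => Q (r • e0v, v + t • e0v)) 0 := by
      have := hQ.contQ
      exact (by fun_prop : Continuous fun t : ℝ => Q (r • e0v, v + t • e0v)).continuousAt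
    have : Q (r • e0v, v + (0:ℝ) • e0v) < δ / 2 := by simp [hq0]; positivity
    filter_upwards [hc.eventually_lt continuousAt_const this] with t ht
    exact Hc_zero hδ ht.le

lemma B_le (hQ : AssumptionA Q F e₀) {δ : ℝ} (hδ : 0 < δ) (r : ℝ) :
    ∫ v : E3, v 0 ^ 2 * (- Gc Q F δ (r • e0v, v)) ≤ Prad Q r := by
  have hQc := hQ.contQ
  have hHc : Continuous (fun v : E3 => Hc δ (Q (r • e0v, v))) := by
    have : Continuous (Hc δ) := continuous_iff_continuousAt.2 fun q => (Hc_deriv δ q).continuousAt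
    fun_prop
  have hHs : HasCompactSupport (fun v : E3 => Hc δ (Q (r • e0v, v))) := by
    refine (slice_supp2 hQ.cpt (r • e0v)).mono ?_
    intro v hv h0
    simp only at h0
    exact hv (by simp only [h0]; exact Hc_zero hδ (by positivity))
  have hGc : Continuous (fun v : E3 => Gc Q F δ (r • e0v, v)) := by
    have := Gc_cont hQ hδ
    fun_prop
  have hGs := slice_supp2 (Gc_supp hQ hδ) (r • e0v)
  have iG : Integrable (fun v : E3 => v 0 * (Gc Q F δ (r • e0v, v) * v 0)) :=
    (by fun_prop : Continuous _).integrable_of_hasCompactSupport (hGs.mul_right.mul_left)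
  have iH := hHc.integrable_of_hasCompactSupport (μ := volume) hHs
  have h := ibp_one (u := fun v : E3 => v 0 * Hc δ (Q (r • e0v, v))) (e := e0v)
    (u' := fun v => Hc δ (Q (r • e0v, v)) + v 0 * (Gc Q F δ (r • e0v, v) * v 0)) (by fun_prop) hHs.mul_left
    (iH.add iG) ?_
  · rw [integral_add iH iG] at h
    have e : ∫ v : E3, v 0 ^ 2 * (- Gc Q F δ (r • e0v, v)) = - ∫ v : E3, v 0 * (Gc Q F δ (r • e0v, v) * v 0) := by
      rw [← integral_neg]; congr 1; ext v; ring
    have e2 : ∫ v : E3, v 0 ^ 2 * (- Gc Q F δ (r • e0v, v)) = ∫ v, Hc δ (Q (r • e0v, v)) := by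
      rw [e]; linarith
    rw [e2]
    refine integral_mono iH ?_ (fun v => Hc_le (hQ.nonneg _))
    exact (by fun_prop : Continuous fun v : E3 => Q (r • e0v, v)).integrable_of_hasCompactSupport (slice_supp2 hQ.cpt _)
  · intro v
    unfold HasLineDerivAt
    have a : HasDerivAt (fun t : ℝ => (v + t • e0v) 0) 1 0 := by
      simpa using (hasDerivAt_id (0:ℝ)).const_add (v 0)
    have := a.mul (HQ_line hQ hδ r v)
    refine this.congr_deriv ?_
    simp

lemma J_sq_le (hQ : AssumptionA Q F e₀) {ξ : Phase → ℝ} (hξ : Continuous ξ)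
    (hc : HasCompactSupport ξ) (hsupp : tsupport ξ ⊆ {z | 0 < Q z}) (r : ℝ) :
    jf ξ 0 (r • e0v) ^ 2 ≤ rhoF (fun z => wt Q F z * ξ z ^ 2) (r • e0v) * Prad Q r := by
  obtain ⟨δ, hδ, hδQ⟩ : ∃ δ, 0 < δ ∧ ∀ z ∈ tsupport ξ, δ ≤ Q z := by
    rcases (tsupport ξ).eq_empty_or_nonempty with h | h
    · exact ⟨1, one_pos, by simp [h]⟩
    · obtain ⟨z, hz, hmin⟩ := hc.exists_isMinOn h hQ.contQ.continuousOn
      exact ⟨Q z, hsupp hz, fun y hy => hmin hy⟩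
  have hs2 : tsupport (fun z => ξ z ^ 2) ⊆ tsupport ξ := by
    apply closure_mono
    intro z hz h0
    exact hz (by simp only [h0]; simp)
  have hwc : Continuous (fun z => wt Q F z * ξ z ^ 2) := wt_mul_cont hQ (hξ.pow 2) (hs2.trans hsupp)
  have hwsupp : HasCompactSupport (fun z => wt Q F z * ξ z ^ 2) :=
    HasCompactSupport.mul_left (hc.of_isClosed_subset (isClosed_tsupport _) hs2)
  have iN : Integrable (fun v : E3 => wt Q F (r • e0v, v) * ξ (r • e0v, v) ^ 2) :=
    (hwc.comp (by fun_prop : Continuous fun v : E3 => (r • e0v, v))).integrable_of_hasCompactSupport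
      (slice_supp2 hwsupp (r • e0v))
  have hGc : Continuous (fun v : E3 => Gc Q F δ (r • e0v, v)) := by
    have := Gc_cont hQ hδ
    fun_prop
  have hGs := slice_supp2 (Gc_supp hQ hδ) (r • e0v)
  have iB : Integrable (fun v : E3 => v 0 ^ 2 * (- Gc Q F δ (r • e0v, v))) :=
    (by fun_prop : Continuous _).integrable_of_hasCompactSupport (HasCompactSupport.mul_left hGs.neg)
  have iJ : Integrable (fun v : E3 => v 0 * ξ (r • e0v, v)) :=
    (by fun_prop : Continuous _).integrable_of_hasCompactSupport (slice_supp2 hc _).mul_left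
  have hlam : ∀ l : ℝ, 0 ≤ Prad Q r * (l * l) + (-2 * jf ξ 0 (r • e0v)) * l
      + rhoF (fun z => wt Q F z * ξ z ^ 2) (r • e0v) := by
    intro l
    have hm : ∫ v : E3, (2 * l) * (v 0 * ξ (r • e0v, v)) ≤ ∫ v : E3, (wt Q F (r • e0v, v) * ξ (r • e0v, v) ^ 2
        + l ^ 2 * (v 0 ^ 2 * (- Gc Q F δ (r • e0v, v)))) := by
      refine integral_mono (iJ.const_mul _) (iN.add (iB.const_mul _)) fun v => ?_
      simp only
      by_cases hz : ξ (r • e0v, v) = 0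
      · rw [hz]
        have hGn : 0 ≤ - Gc Q F δ (r • e0v, v) := by
          by_cases hq : 0 < Q (r • e0v, v)
          · have h1 := Fe_neg hQ (mem_S hQ hq)
            have h2 := chi_nonneg δ (Q (r • e0v, v))
            simp only [Gc]; nlinarith
          · have hq0 : Q (r • e0v, v) = 0 := le_antisymm (not_lt.1 hq) (hQ.nonneg _)
            simp [Gc, hq0, chi_zero hδ (by positivity : (0:ℝ) ≤ δ / 2)]
        have : 0 ≤ l ^ 2 * (v 0 ^ 2 * (- Gc Q F δ (r • e0v, v))) := by positivity
        simpa using this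
      · have hzs : (r • e0v, v) ∈ tsupport ξ := subset_tsupport _ hz
        have h1 := Fe_neg hQ (mem_S hQ (hsupp hzs))
        have hG : Gc Q F δ (r • e0v, v) = Fe F (microE Q (r • e0v, v), ellOf (r • e0v, v)) := by
          rw [Gc, chi_one hδ (hδQ _ hzs), one_mul]
        have hw : wt Q F (r • e0v, v) = 1 / (- Fe F (microE Q (r • e0v, v), ellOf (r • e0v, v))) := by
          rw [← abs_of_neg h1]; rfl
        rw [hG, hw]
        set a := - Fe F (microE Q (r • e0v, v), ellOf (r • e0v, v)) with ha
        have hap : 0 < a := by rw [ha]; linarith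
        rw [← sub_nonneg]
        have : 1 / a * ξ (r • e0v, v) ^ 2 + l ^ 2 * (v 0 ^ 2 * a) - 2 * l * (v 0 * ξ (r • e0v, v))
          = (ξ (r • e0v, v) - l * v 0 * a) ^ 2 / a := by field_simp; ring
        rw [this]; positivity
    rw [integral_const_mul, integral_add iN (iB.const_mul _), integral_const_mul] at hm
    have hB := mul_le_mul_of_nonneg_left (B_le hQ hδ r) (sq_nonneg l)
    simp only [jf, rhoF] at hm ⊢
    nlinarith
  have := discrim_le_zero hlam
  unfold discrim at this
  nlinarith

lemma wt_sph (hQ : AssumptionA Q F e₀) {ξ : Phase → ℝ} (hs : SphSym ξ) :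
    SphSym (fun z => wt Q F z * ξ z ^ 2) := by
  intro R hR z
  have h1 : ellOf (R z.1, R z.2) = ellOf z := by simp [ellOf]
  have h2 : microE Q (R z.1, R z.2) = microE Q z := by
    simp only [microE, R.norm_map]
    rw [phiF_rot hQ.sph (R z.1), phiF_rot hQ.sph z.1, R.norm_map]
  simp only [wt, h1, h2, hs R hR z]

lemma step2 (hQ : AssumptionA Q F e₀) {ξ : Phase → ℝ} (hd : ContDiff ℝ 1 ξ)
    (hc : HasCompactSupport ξ) (hsupp : tsupport ξ ⊆ {z | 0 < Q z}) (hs : SphSym ξ) :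
    fieldSq (fun z => fderiv ℝ ξ z (tdir Q z)) ≤ ∫ z, wt Q F z * (ξ z ^ 2 * Prad Q ‖z.1‖) := by
  have hξ := hd.continuous
  have hs2 : tsupport (fun z => ξ z ^ 2) ⊆ tsupport ξ := by
    apply closure_mono
    intro z hz h0
    exact hz (by simp only [h0]; simp)
  have hwc : Continuous (fun z => wt Q F z * ξ z ^ 2) := wt_mul_cont hQ (hξ.pow 2) (hs2.trans hsupp)
  have hwsupp : HasCompactSupport (fun z => wt Q F z * ξ z ^ 2) :=
    HasCompactSupport.mul_left (hc.of_isClosed_subset (isClosed_tsupport _) hs2)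
  have hP := Prad_cont hQ.contQ hQ.cpt
  have hNc := rhoF_cont hwc hwsupp
  have hNs := rhoF_supp hwsupp
  have h1 : fieldSq (fun z => fderiv ℝ ξ z (tdir Q z)) ≤
      ∫ x : E3, rhoF (fun z => wt Q F z * ξ z ^ 2) x * Prad Q ‖x‖ := by
    unfold fieldSq
    refine integral_mono_of_nonneg (Eventually.of_forall fun x => sq_nonneg _) ?_ (Eventually.of_forall fun x => ?_)
    · exact (by fun_prop : Continuous _).integrable_of_hasCompactSupport hNs.mul_right
    · refine (gradPhi_T hQ hd hc hs x).trans ((J_sq_le hQ hξ hc hsupp ‖x‖).trans (le_of_eq ?_))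
      simp only
      rw [rhoF_radial (wt_sph hQ hs) x]
  refine h1.trans (le_of_eq ?_)
  have hi : Integrable (fun z : Phase => wt Q F z * ξ z ^ 2 * Prad Q ‖z.1‖) :=
    (by fun_prop : Continuous _).integrable_of_hasCompactSupport hwsupp.mul_right
  have e : ∀ z : Phase, wt Q F z * (ξ z ^ 2 * Prad Q ‖z.1‖) = wt Q F z * ξ z ^ 2 * Prad Q ‖z.1‖ :=
    fun z => by ring
  simp_rw [e]
  rw [Measure.volume_eq_prod] at hi ⊢
  rw [integral_prod _ hi]
  congr 1; ext x
  simp only [rhoF]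
  rw [integral_mul_const]

end

/-- Antonov's coercivity inequality. -/
theorem stmt18 (Q : Phase → ℝ) (F : ℝ → ℝ → ℝ) (e₀ : ℝ) (hQ : AssumptionA Q F e₀)
    (ξ : Phase → ℝ) (hξsm : ContDiff ℝ (⊤ : ℕ∞) ξ) (hξc : HasCompactSupport ξ)
    (hξsupp : tsupport ξ ⊆ {z : Phase | 0 < Q z}) (hξsph : SphSym ξ)
    (hξodd : ∀ z : Phase, ξ (z.1, -z.2) = - ξ z) :
    (∫ z in {z : Phase | 0 < Q z},
        (transportT Q ξ z) ^ 2 / |deriv (fun e => F e (ellOf z)) (microE Q z)|)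
      - fieldSq (transportT Q ξ)
      ≥ ∫ z in {z : Phase | 0 < Q z},
          (ξ z) ^ 2 / |deriv (fun e => F e (ellOf z)) (microE Q z)| *
            (deriv (phiRad Q) ‖z.1‖ / ‖z.1‖) := by
  have hsm1 : ContDiff ℝ 1 ξ := contDiff_infty.1 hξsm 1
  have hT : transportT Q ξ = fun z => fderiv ℝ ξ z (tdir Q z) := by
    ext z
    rw [transportT, gradPhi_eq hQ.contQ hQ.cpt hQ.sph]; rfl
  have h0 := odd_zero hξsph hξodd
  have hP := Prad_cont hQ.contQ hQ.cpt
  have hk := kf_cont hP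
  have hξ := hsm1.continuous
  have a := step1 hQ hξsm hξc hξsupp h0
  have b := step2 hQ hsm1 hξc hξsupp hξsph
  have hsub : ∀ X : Phase → ℝ, (∀ z, ξ z = 0 → X z = 0) → tsupport X ⊆ tsupport ξ := by
    intro X hX
    apply closure_mono
    intro z hz hz0
    exact hz (hX z hz0)
  have mk : ∀ X : Phase → ℝ, Continuous X → (∀ z, ξ z = 0 → X z = 0) → Integrable (fun z => wt Q F z * X z) :=
    fun X hX hX0 => wt_mul_int hQ hX (hξc.of_isClosed_subset (isClosed_tsupport _) (hsub X hX0))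
      ((hsub X hX0).trans hξsupp)
  have ik := mk (fun z => ξ z ^ 2 * kf (Prad Q) ‖z.1‖) (by fun_prop) (fun z hz => by simp [hz])
  have ip := mk (fun z => ξ z ^ 2 * Prad Q ‖z.1‖) (by fun_prop) (fun z hz => by simp [hz])
  have e1 : ∫ z, wt Q F z * (ξ z ^ 2 * BF Q z) = (∫ z, wt Q F z * (ξ z ^ 2 * kf (Prad Q) ‖z.1‖))
      + ∫ z, wt Q F z * (ξ z ^ 2 * Prad Q ‖z.1‖) := by
    rw [← integral_add ik ip]; congr 1; ext z; simp only [BF]; ring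
  have hzero : ∀ z, z ∉ {z : Phase | 0 < Q z} → z ∉ tsupport ξ := fun z hz h => hz (hξsupp h)
  have e2 : (∫ z in {z : Phase | 0 < Q z},
        (transportT Q ξ z) ^ 2 / |deriv (fun e => F e (ellOf z)) (microE Q z)|)
      = ∫ z, wt Q F z * (fderiv ℝ ξ z (tdir Q z)) ^ 2 := by
    rw [setIntegral_eq_integral_of_forall_compl_eq_zero]
    · congr 1; ext z; rw [hT, wt]; ring
    · intro z hz
      have : fderiv ℝ ξ z = 0 := by
        by_contra h
        exact hzero z hz (support_fderiv_subset ℝ (f := ξ) h)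
      simp [hT, this]
  have e3 : (∫ z in {z : Phase | 0 < Q z},
          (ξ z) ^ 2 / |deriv (fun e => F e (ellOf z)) (microE Q z)| *
            (deriv (phiRad Q) ‖z.1‖ / ‖z.1‖)) = ∫ z, wt Q F z * (ξ z ^ 2 * kf (Prad Q) ‖z.1‖) := by
    rw [setIntegral_eq_integral_of_forall_compl_eq_zero]
    · congr 1; ext z
      by_cases hz : z.1 = 0
      · have : ξ z = 0 := h0 z.1 z.2 (by rw [hz]; simp)
        simp [this]
      · rw [phiRad_deriv hQ.contQ hQ.cpt hQ.sph (norm_pos_iff.2 hz), wt]; ring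
    · intro z hz
      simp [image_eq_zero_of_notMem_tsupport (hzero z hz)]
  rw [e2, e3, hT, ge_iff_le]
  linarith
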